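/- arXiv:2405.08634 — 2 statements merged into one kernel-verified Lean document; each statement's English description precedes it below -/
import Mathlib

section
/- Suppose b = 0 and τ₀ = τ₁ = 1, a ∈ (−1,1), the spectral controllability assumption holds (for every s ∈ ℂ, (F₀(s), F₁(s)) ≠ (0,0), where F₁(s) = ∫₀¹ M(ν)exp(−νs)dν), M and N are twice continuously differentiable on [0,1], a·M(0) − M(1) ≠ 0, and F₀(0) ≠ 0. Then there exists a unique pair of continuously differentiable functions f, g : [0,1] → ℝ such that I₁(ν) = 0 for all ν ∈ [0,1) and I₃(ν) = 0 for all ν ∈ [1,2]. -/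
open MeasureTheory Set

noncomputable section

/-- `f` is piecewise continuous on `[a,b]`: continuous off a finite set and bounded. -/
def PwContOn (f : ℝ → ℝ) (a b : ℝ) : Prop :=
  (∃ S : Finset ℝ, ContinuousOn f (Set.Icc a b \ ↑S)) ∧
    ∃ C : ℝ, ∀ x ∈ Set.Icc a b, |f x| ≤ C

/-- `f` is piecewise continuously differentiable on `[a,b]`. -/
def PwC1On (f : ℝ → ℝ) (a b : ℝ) : Prop :=
  PwContOn f a b ∧
    ∃ S : Finset ℝ, DifferentiableOn ℝ f (Set.Icc a b \ ↑S) ∧ PwContOn (deriv f) a b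

/-- Sup norm of the partial trajectory `θ ∈ [-τ,0] ↦ φ(t+θ)`. -/
def wNorm (φ : ℝ → ℝ) (τ t : ℝ) : ℝ :=
  sSup ((fun θ => |φ (t + θ)|) '' Set.Icc (-τ) 0)

/-- `F₀(s) = 1 - a e^{-τ₀ s} - ∫₀^{τ₀} N(ν) e^{-ν s} dν`. -/
def F0 (a τ₀ : ℝ) (N : ℝ → ℝ) (s : ℂ) : ℂ :=
  1 - (a : ℂ) * Complex.exp (-(τ₀ : ℂ) * s)
    - ∫ ν in (0:ℝ)..τ₀, (N ν : ℂ) * Complex.exp (-(ν : ℂ) * s)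

/-- `F₁(s) = b e^{-τ₁ s} + ∫₀^{τ₁} M(ν) e^{-ν s} dν`. -/
def F1 (b τ₁ : ℝ) (M : ℝ → ℝ) (s : ℂ) : ℂ :=
  (b : ℂ) * Complex.exp (-(τ₁ : ℂ) * s)
    + ∫ ν in (0:ℝ)..τ₁, (M ν : ℂ) * Complex.exp (-(ν : ℂ) * s)

/-- `I₁(ν)`, for `ν ∈ [0,τ₀]`. -/
def I1 (N M f g : ℝ → ℝ) (ν : ℝ) : ℝ :=
  g ν + N ν + (∫ η in (0:ℝ)..ν, f η * M (ν - η)) - ∫ η in (0:ℝ)..ν, g η * N (ν - η)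

/-- `I₂(ν)`, for `ν ∈ (τ₀,τ₁]`. -/
def I2 (a τ₀ : ℝ) (N M f g : ℝ → ℝ) (ν : ℝ) : ℝ :=
  g ν - a * g (ν - τ₀) + (∫ η in (0:ℝ)..τ₀, f η * M (ν - η))
    - ∫ η in (ν - τ₀)..ν, g η * N (ν - η)

/-- `I₃(ν)`, for `ν ∈ [τ₁,τ₀+τ₁]`. -/
def I3 (a b τ₀ τ₁ : ℝ) (N M f g : ℝ → ℝ) (ν : ℝ) : ℝ :=
  b * f (ν - τ₁) + (∫ η in (ν - τ₁)..τ₀, f η * M (ν - η))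
    - a * g (ν - τ₀) - ∫ η in (ν - τ₀)..τ₁, g η * N (ν - η)

/-- `I₁(ν)` for the degenerate case `b = 0`, `τ₀ = τ₁ = 1`, `ν ∈ [0,1]`. -/
def J1 (M N f g : ℝ → ℝ) (ν : ℝ) : ℝ :=
  g ν + M 0 * f ν + N ν + (∫ η in (0:ℝ)..ν, f η * deriv M (ν - η))
    - ∫ η in (0:ℝ)..ν, g η * N (ν - η)

/-- `I₃(ν)` for the degenerate case `b = 0`, `τ₀ = τ₁ = 1`, `ν ∈ [1,2]`. -/
def J3 (a : ℝ) (M N f g : ℝ → ℝ) (ν : ℝ) : ℝ :=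
  -(M 1) * f (ν - 1) + (∫ η in (ν - 1)..(1:ℝ), f η * deriv M (ν - η))
    - a * g (ν - 1) - ∫ η in (ν - 1)..(1:ℝ), g η * N (ν - η)


def cv (f k : ℝ → ℂ) (x : ℝ) : ℂ := ∫ t in (0:ℝ)..x, f t * k (x - t)

lemma cv_cont {f k : ℝ → ℂ} (hf : Continuous f) (hk : Continuous k) : Continuous (cv f k) := by
  unfold cv
  apply intervalIntegral.continuous_parametric_intervalIntegral_of_continuous _ continuous_id
  fun_prop

lemma cv_congr {f f' k k' : ℝ → ℂ} (hf : ∀ x ∈ Icc (0:ℝ) 1, f x = f' x)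
    (hk : ∀ x ∈ Icc (0:ℝ) 1, k x = k' x) {x : ℝ} (hx : x ∈ Icc (0:ℝ) 1) : cv f k x = cv f' k' x := by
  unfold cv
  apply intervalIntegral.integral_congr
  intro t ht
  rw [uIcc_of_le hx.1] at ht
  simp only
  rw [hf t ⟨ht.1, ht.2.trans hx.2⟩, hk (x - t) ⟨by linarith [ht.2], by linarith [ht.1, hx.2]⟩]

lemma cv_comm (f k : ℝ → ℂ) (x : ℝ) : cv f k x = cv k f x := by
  unfold cv
  have := intervalIntegral.integral_comp_sub_left (a := 0) (b := x) (fun t => f t * k (x - t)) x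
  simp only [sub_self, sub_zero, sub_sub_cancel] at this
  rw [← this]
  simp only [mul_comm]

lemma cv_add_left {f g k : ℝ → ℂ} (hf : Continuous f) (hg : Continuous g) (hk : Continuous k) (x : ℝ) :
    cv (fun t => f t + g t) k x = cv f k x + cv g k x := by
  unfold cv
  rw [← intervalIntegral.integral_add (Continuous.intervalIntegrable (by fun_prop) _ _)
    (Continuous.intervalIntegrable (by fun_prop) _ _)]
  simp only [add_mul]

lemma cv_smul_left (c : ℂ) (f k : ℝ → ℂ) (x : ℝ) :
    cv (fun t => c * f t) k x = c * cv f k x := by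
  unfold cv
  rw [← intervalIntegral.integral_const_mul]
  simp only [mul_assoc]

lemma cv_const_left (c : ℂ) (k : ℝ → ℂ) (x : ℝ) :
    cv (fun _ => c) k x = c * ∫ t in (0:ℝ)..x, k t := by
  rw [cv_comm]; unfold cv
  rw [intervalIntegral.integral_mul_const, mul_comm]

lemma prim_cont {k : ℝ → ℂ} (hk : Continuous k) : Continuous (fun x => ∫ t in (0:ℝ)..x, k t) :=
  intervalIntegral.continuous_primitive (fun _ _ => hk.intervalIntegrable _ _) 0

lemma cv_int {f k : ℝ → ℂ} (hf : Continuous f) (hk : Continuous k) {x : ℝ} (hx : 0 ≤ x) :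
    cv f (fun y => ∫ t in (0:ℝ)..y, k t) x = ∫ y in (0:ℝ)..x, cv f k y := by
  have hint : IntegrableOn (Function.uncurry fun y t : ℝ => if t ≤ y then f t * k (y - t) else 0)
      (uIoc 0 x ×ˢ uIoc 0 x) := by
    have hc : Continuous (fun p : ℝ × ℝ => f p.2 * k (p.1 - p.2)) := by fun_prop
    have h1 : IntegrableOn (fun p : ℝ × ℝ => f p.2 * k (p.1 - p.2)) (uIoc 0 x ×ˢ uIoc 0 x) := by
      refine (hc.continuousOn.integrableOn_compact (K := uIcc 0 x ×ˢ uIcc 0 x) (isCompact_uIcc.prod isCompact_uIcc)).mono_set ?_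
      exact prod_mono uIoc_subset_uIcc uIoc_subset_uIcc
    have hms : MeasurableSet {p : ℝ × ℝ | p.2 ≤ p.1} := measurableSet_le measurable_snd measurable_fst
    refine (Integrable.indicator h1 hms).congr (Filter.Eventually.of_forall ?_)
    rintro ⟨y, t⟩
    simp [indicator, Function.uncurry]
  have sw := intervalIntegral_intervalIntegral_swap hint
  have e1 : ∫ y in (0:ℝ)..x, cv f k y = ∫ y in (0:ℝ)..x, ∫ t in (0:ℝ)..x, if t ≤ y then f t * k (y - t) else 0 := by
    apply intervalIntegral.integral_congr
    intro y hy
    rw [uIcc_of_le hx] at hy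
    simp only [cv]
    rw [← intervalIntegral.integral_add_adjacent_intervals (b := y) (c := x)]
    · rw [intervalIntegral.integral_congr (g := fun t => if t ≤ y then f t * k (y - t) else 0) (a := 0) (b := y)]
      · rw [intervalIntegral.integral_congr_ae (g := fun _ => (0:ℂ)) (a := y) (b := x)]
        · simp
        · refine Filter.Eventually.of_forall fun t ht => ?_
          rw [uIoc_of_le hy.2] at ht
          simp [ht.1]
      · intro t ht
        rw [uIcc_of_le hy.1] at ht
        simp [ht.2]
    · refine (Continuous.intervalIntegrable (u := fun t => f t * k (y - t)) (by fun_prop) 0 y).congr ?_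
      intro t ht
      rw [uIoc_of_le hy.1] at ht
      simp [ht.2]
    · refine (Continuous.intervalIntegrable (u := fun t => (0:ℂ)) (by fun_prop) y x).congr ?_
      intro t ht
      rw [uIoc_of_le hy.2] at ht
      simp [ht.1]
  rw [e1, sw]
  unfold cv
  apply intervalIntegral.integral_congr
  intro t ht
  rw [uIcc_of_le hx] at ht
  simp only
  rw [← intervalIntegral.integral_add_adjacent_intervals (b := t) (c := x)]
  · rw [intervalIntegral.integral_congr_ae (g := fun y => f t * k (y - t)) (a := t) (b := x),
      intervalIntegral.integral_congr_ae (g := fun _ => (0:ℂ)) (a := 0) (b := t)]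
    · rw [intervalIntegral.integral_const_mul, intervalIntegral.integral_comp_sub_right (fun y => k y)]
      simp
    · have : ∀ᵐ y : ℝ, y ≠ t := by simp [ae_iff]
      filter_upwards [this] with y hy h
      rw [uIoc_of_le ht.1] at h
      have : y < t := lt_of_le_of_ne h.2 hy
      simp [this]
    · refine Filter.Eventually.of_forall fun y hy => ?_
      rw [uIoc_of_le ht.2] at hy
      simp [hy.1.le]
  · refine (Continuous.intervalIntegrable (u := fun t => (0:ℂ)) (by fun_prop) 0 t).congr_ae ?_
    rw [Filter.EventuallyEq, ae_restrict_iff' measurableSet_uIoc]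
    have : ∀ᵐ y : ℝ, y ≠ t := by simp [ae_iff]
    filter_upwards [this] with y hy h
    rw [uIoc_of_le ht.1] at h
    have : y < t := lt_of_le_of_ne h.2 hy
    simp [this]
  · refine (Continuous.intervalIntegrable (u := fun y => f t * k (y - t)) (by fun_prop) t x).congr ?_
    intro y hy
    rw [uIoc_of_le ht.2] at hy
    simp [hy.1.le]

/-- Primitive form of a convolution with an absolutely continuous kernel. -/
lemma cv_prim {f k : ℝ → ℂ} (k0 : ℂ) (hf : Continuous f) (hk : Continuous k) {x : ℝ} (hx : 0 ≤ x) :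
    cv f (fun y => k0 + ∫ t in (0:ℝ)..y, k t) x = ∫ y in (0:ℝ)..x, (k0 * f y + cv f k y) := by
  rw [cv_comm, cv_add_left continuous_const (prim_cont hk) hf, cv_const_left, cv_comm,
    cv_int hf hk hx, intervalIntegral.integral_add, intervalIntegral.integral_const_mul]
  · exact Continuous.intervalIntegrable (by fun_prop) _ _
  · exact Continuous.intervalIntegrable (cv_cont hf hk) _ _

/-- Invariance of the convolution equations. -/
lemma inv_lemma (α c m0 : ℂ) {m1 n f g : ℝ → ℂ} (hm1 : Continuous m1) (hn : Continuous n)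
    (hf : Continuous f) (hg : Continuous g) {x : ℝ} (hx : 0 ≤ x) :
    α * ((∫ t in (0:ℝ)..x, g t) - c * (m0 + ∫ t in (0:ℝ)..x, m1 t))
      + m0 * (α * c + ∫ t in (0:ℝ)..x, (f t + c * n t))
      + cv (fun y => α * c + ∫ t in (0:ℝ)..y, (f t + c * n t)) m1 x
      + cv (fun y => (∫ t in (0:ℝ)..y, g t) - c * (m0 + ∫ t in (0:ℝ)..y, m1 t)) n x
    = ∫ y in (0:ℝ)..x, (α * g y + m0 * f y + cv f m1 y + cv g n y) := by
  have hM : Continuous (fun y => m0 + ∫ t in (0:ℝ)..y, m1 t) := continuous_const.add (prim_cont hm1)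
  have hG := prim_cont hg
  have hfn : Continuous fun t => f t + c * n t := by fun_prop
  have e1 : cv (fun y => α * c + ∫ t in (0:ℝ)..y, (f t + c * n t)) m1 x
      = α * c * (∫ t in (0:ℝ)..x, m1 t) + ((∫ y in (0:ℝ)..x, cv f m1 y)
        + c * ∫ y in (0:ℝ)..x, cv n m1 y) := by
    rw [cv_add_left continuous_const (prim_cont hfn) hm1, cv_const_left, cv_comm (fun y => ∫ t in (0:ℝ)..y, (f t + c * n t)),
      cv_int hm1 hfn hx]
    congr 1
    rw [← intervalIntegral.integral_const_mul, ← intervalIntegral.integral_add]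
    · apply intervalIntegral.integral_congr
      intro y _
      simp only
      rw [cv_comm, cv_add_left hf (by fun_prop) hm1, cv_smul_left]
    · exact (cv_cont hf hm1).intervalIntegrable _ _
    · exact ((cv_cont hn hm1).const_smul c).intervalIntegrable _ _
  have e2 : cv (fun y => (∫ t in (0:ℝ)..y, g t) - c * (m0 + ∫ t in (0:ℝ)..y, m1 t)) n x
      = (∫ y in (0:ℝ)..x, cv g n y) - c * (m0 * (∫ t in (0:ℝ)..x, n t) + ∫ y in (0:ℝ)..x, cv n m1 y) := by
    have : (fun y => (∫ t in (0:ℝ)..y, g t) - c * (m0 + ∫ t in (0:ℝ)..y, m1 t))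
      = fun y => (∫ t in (0:ℝ)..y, g t) + (-c) * (m0 + ∫ t in (0:ℝ)..y, m1 t) := by
      funext y; ring
    rw [this, cv_add_left hG (by fun_prop) hn, cv_smul_left, cv_comm, cv_int hn hg hx,
      cv_comm _ n, cv_prim m0 hn hm1 hx, intervalIntegral.integral_add, intervalIntegral.integral_const_mul]
    · simp only [cv_comm n g]; ring
    · exact Continuous.intervalIntegrable (by fun_prop) _ _
    · exact (cv_cont hn hm1).intervalIntegrable _ _
  rw [e1, e2, intervalIntegral.integral_add, intervalIntegral.integral_add, intervalIntegral.integral_add,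
    intervalIntegral.integral_add, intervalIntegral.integral_const_mul,
    intervalIntegral.integral_const_mul, intervalIntegral.integral_const_mul]
  · ring
  all_goals first
    | exact Continuous.intervalIntegrable (by fun_prop) _ _
    | exact (cv_cont hf hm1).intervalIntegrable _ _
    | exact (cv_cont hg hn).intervalIntegrable _ _
    | exact Continuous.intervalIntegrable ((show Continuous fun y => α * g y + m0 * f y by fun_prop).add (cv_cont hf hm1)) _ _

lemma fred {X : Type*} [NormedAddCommGroup X] [NormedSpace ℂ X] [CompleteSpace X]
    (C : X →L[ℂ] X) (hC : IsCompactOperator C) (T : X →ₗ[ℂ] X)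
    (hT : ∀ w, C w = w → C (T w) = T w)
    (hno : ∀ w (l : ℂ), C w = w → T w = l • w → w = 0) :
    (∀ w, C w = w → w = 0) ∧ ∀ r, ∃ w, w - C w = r := by
  have hinj : ∀ w, C w = w → w = 0 := by
    intro w hw
    by_contra hw0
    let S := Module.End.eigenspace C.toLinearMap 1
    have hS : ∀ v, v ∈ S ↔ C v = v := by
      intro v; simp [S]
    have hfd : FiniteDimensional ℂ S := by
      have hcl : IsClosed (S : Set X) := by
        have : (S : Set X) = {v | C v = v} := by ext v; exact hS v
        rw [this]
        exact isClosed_eq C.continuous continuous_id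
      have h1 : IsCompactOperator (Set.codRestrict (C ∘ S.subtypeL) S
          (fun v => by
            have := (hS _).1 v.2
            simp [this])) := (hC.comp_clm S.subtypeL).codRestrict _ hcl
      apply FiniteDimensional.of_isCompactOperator_id
      have h2 : (id : S → S) = Set.codRestrict (C ∘ S.subtypeL) S
          (fun v => by
            have := (hS _).1 v.2
            simp [this]) := by
        funext v
        apply Subtype.ext
        simpa using ((hS _).1 v.2).symm
      rw [h2]
      exact h1
    have hTS : ∀ v ∈ S, T v ∈ S := fun v hv => (hS _).2 (hT v ((hS v).1 hv))
    have : Nontrivial S := ⟨⟨⟨w, (hS w).2 hw⟩, 0, fun h => hw0 (congrArg Subtype.val h)⟩⟩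
    obtain ⟨l, hl⟩ := Module.End.exists_eigenvalue (T.restrict hTS)
    obtain ⟨v, hv⟩ := hl.exists_hasEigenvector
    apply hv.2
    have h2 := hv.apply_eq_smul
    have := hno v.1 l ((hS _).1 v.2) (by simpa using congrArg Subtype.val h2)
    exact Subtype.ext this
  refine ⟨hinj, ?_⟩
  rcases hC.hasEigenvalue_or_mem_resolventSet (μ := (1:ℂ)) one_ne_zero with h | h
  · obtain ⟨v, hv⟩ := h.exists_hasEigenvector
    exact absurd (hinj v (by simpa using hv.apply_eq_smul)) hv.2
  · rw [spectrum.mem_resolventSet_iff, ContinuousLinearMap.isUnit_iff_bijective] at h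
    intro r
    obtain ⟨w, hw⟩ := h.2 r
    exact ⟨w, by simpa using hw⟩

/-- The generic convolution equation. -/
def Q (α m0 : ℂ) (m1 n f g : ℝ → ℂ) (x : ℝ) : ℂ :=
  α * g x + m0 * f x + cv f m1 x + cv g n x

/-- Reflection of a function. -/
def rf (f : ℝ → ℂ) (x : ℝ) : ℂ := f (1 - x)

def ng (f : ℝ → ℂ) (x : ℝ) : ℂ := - f x

lemma rf_cont {f : ℝ → ℂ} (hf : Continuous f) : Continuous (rf f) := by
  unfold rf; fun_prop

lemma ng_cont {f : ℝ → ℂ} (hf : Continuous f) : Continuous (ng f) := by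
  unfold ng; fun_prop

lemma Q_congr {α m0 : ℂ} {m1 n f g f' g' : ℝ → ℂ} (hf : ∀ x ∈ Icc (0:ℝ) 1, f x = f' x)
    (hg : ∀ x ∈ Icc (0:ℝ) 1, g x = g' x) {x : ℝ} (hx : x ∈ Icc (0:ℝ) 1) :
    Q α m0 m1 n f g x = Q α m0 m1 n f' g' x := by
  unfold Q
  rw [hf x hx, hg x hx, cv_congr hf (fun _ _ => rfl) hx, cv_congr hg (fun _ _ => rfl) hx]

lemma Q_neg {α m0 : ℂ} {m1 n f g : ℝ → ℂ} (x : ℝ) :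
    Q α m0 m1 n (ng f) (ng g) x = - Q α m0 m1 n f g x := by
  have h : ∀ f k : ℝ → ℂ, cv (ng f) k x = - cv f k x := by
    intro f k; simp [cv, ng]
  unfold Q
  rw [h, h]; simp only [ng]; ring

lemma int_rf (f : ℝ → ℂ) (x : ℝ) : ∫ t in (0:ℝ)..x, rf f t = ∫ t in (1 - x)..1, f t := by
  unfold rf
  rw [intervalIntegral.integral_comp_sub_left (fun t => f t)]; simp

lemma int_split {f : ℝ → ℂ} (hf : Continuous f) (x : ℝ) :
    ∫ t in (0:ℝ)..(1 - x), f t = (∫ t in (0:ℝ)..1, f t) - ∫ t in (0:ℝ)..x, rf f t := by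
  rw [int_rf, ← intervalIntegral.integral_add_adjacent_intervals (a := 0) (b := 1 - x) (c := 1) (hf.intervalIntegrable _ _)
    (hf.intervalIntegrable _ _)]
  ring

lemma cv_sum {f k : ℝ → ℂ} (hf : Continuous f) (hk : Continuous k) :
    cv f (fun y => ∫ t in (0:ℝ)..y, k t) 1 + cv (rf f) (fun y => ∫ t in (0:ℝ)..y, rf k t) 1
      = (∫ t in (0:ℝ)..1, f t) * ∫ t in (0:ℝ)..1, k t := by
  have h2 : cv (rf f) (fun y => ∫ t in (0:ℝ)..y, rf k t) 1
      = ∫ t in (0:ℝ)..1, f t * ∫ s in (0:ℝ)..t, rf k s := by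
    have := int_rf (fun t => f t * ∫ s in (0:ℝ)..t, rf k s) 1
    rw [sub_self] at this
    rw [← this]; rfl
  have hp := prim_cont hk
  have hp2 := prim_cont (rf_cont hk)
  rw [h2, cv, ← intervalIntegral.integral_add, ← intervalIntegral.integral_mul_const]
  · apply intervalIntegral.integral_congr
    intro t _
    simp only
    rw [int_split hk]; ring
  · exact Continuous.intervalIntegrable (hf.mul (hp.comp (by fun_prop : Continuous fun t : ℝ => 1 - t))) _ _
  · exact Continuous.intervalIntegrable (hf.mul hp2) _ _

lemma Q_int {α m0 : ℂ} {m1 n f g : ℝ → ℂ} (hm1 : Continuous m1) (hn : Continuous n)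
    (hf : Continuous f) (hg : Continuous g) (h : ∀ x ∈ Icc (0:ℝ) 1, Q α m0 m1 n f g x = 0) :
    α * (∫ t in (0:ℝ)..1, g t) + m0 * (∫ t in (0:ℝ)..1, f t)
      + cv f (fun y => ∫ t in (0:ℝ)..y, m1 t) 1 + cv g (fun y => ∫ t in (0:ℝ)..y, n t) 1 = 0 := by
  have h0 : ∫ x in (0:ℝ)..1, Q α m0 m1 n f g x = 0 := by
    rw [intervalIntegral.integral_congr (g := fun _ => (0:ℂ))]
    · simp
    · intro x hx
      rw [uIcc_of_le zero_le_one] at hx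
      exact h x hx
  unfold Q at h0
  rw [intervalIntegral.integral_add, intervalIntegral.integral_add, intervalIntegral.integral_add,
    intervalIntegral.integral_const_mul,
    intervalIntegral.integral_const_mul] at h0
  · rw [cv_int hf hm1 zero_le_one, cv_int hg hn zero_le_one, h0]
  all_goals first
    | exact Continuous.intervalIntegrable (by fun_prop) _ _
    | exact (cv_cont hf hm1).intervalIntegrable _ _
    | exact (cv_cont hg hn).intervalIntegrable _ _
    | exact Continuous.intervalIntegrable ((show Continuous fun y => α * g y + m0 * f y by fun_prop).add (cv_cont hf hm1)) _ _

lemma intg_zero {a m0 : ℂ} {m1 n f g : ℝ → ℂ} (hm1 : Continuous m1) (hn : Continuous n)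
    (hf : Continuous f) (hg : Continuous g)
    (hF : 1 - a - (∫ t in (0:ℝ)..1, n t) ≠ 0)
    (h1 : ∀ x ∈ Icc (0:ℝ) 1, Q 1 m0 m1 (ng n) f g x = 0)
    (h3 : ∀ x ∈ Icc (0:ℝ) 1, Q a (m0 + ∫ t in (0:ℝ)..1, m1 t) (ng (rf m1)) (rf n) (rf f) (rf g) x = 0) :
    ∫ t in (0:ℝ)..1, g t = 0 := by
  have e1 := Q_int hm1 (ng_cont hn) hf hg h1
  have e3 := Q_int (ng_cont (rf_cont hm1)) (rf_cont hn) (rf_cont hf) (rf_cont hg) h3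
  have s1 := cv_sum hf hm1
  have s2 := cv_sum hg hn
  have n1 : ∀ f k : ℝ → ℂ, cv f (fun y => ∫ t in (0:ℝ)..y, ng k t) 1 = - cv f (fun y => ∫ t in (0:ℝ)..y, k t) 1 := by
    intro f k; simp [cv, ng]
  rw [n1] at e1 e3
  have r : ∀ f : ℝ → ℂ, ∫ t in (0:ℝ)..1, rf f t = ∫ t in (0:ℝ)..1, f t := by
    intro f; rw [int_rf]; simp
  rw [r, r] at e3
  have : (1 - a - (∫ t in (0:ℝ)..1, n t)) * ∫ t in (0:ℝ)..1, g t = 0 := by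
    linear_combination e1 - e3 - s1 + s2
  exact (mul_eq_zero.1 this).resolve_left hF

def TF (c : ℂ) (n f : ℝ → ℂ) (x : ℝ) : ℂ := c + ∫ t in (0:ℝ)..x, (f t - c * n t)
def TG (c m0 : ℂ) (m1 g : ℝ → ℂ) (x : ℝ) : ℂ := (∫ t in (0:ℝ)..x, g t) - c * (m0 + ∫ t in (0:ℝ)..x, m1 t)

lemma Q_inv {a m0 c : ℂ} {m1 n f g : ℝ → ℂ} (hm1 : Continuous m1) (hn : Continuous n)
    (hf : Continuous f) (hg : Continuous g)
    (hF : 1 - a - (∫ t in (0:ℝ)..1, n t) ≠ 0)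
    (hc : c * (1 - a - (∫ t in (0:ℝ)..1, n t)) = - ∫ t in (0:ℝ)..1, f t)
    (h1 : ∀ x ∈ Icc (0:ℝ) 1, Q 1 m0 m1 (ng n) f g x = 0)
    (h3 : ∀ x ∈ Icc (0:ℝ) 1, Q a (m0 + ∫ t in (0:ℝ)..1, m1 t) (ng (rf m1)) (rf n) (rf f) (rf g) x = 0) :
    (∀ x ∈ Icc (0:ℝ) 1, Q 1 m0 m1 (ng n) (TF c n f) (TG c m0 m1 g) x = 0) ∧
    (∀ x ∈ Icc (0:ℝ) 1, Q a (m0 + ∫ t in (0:ℝ)..1, m1 t) (ng (rf m1)) (rf n)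
      (rf (TF c n f)) (rf (TG c m0 m1 g)) x = 0) := by
  have hg0 := intg_zero hm1 hn hf hg hF h1 h3
  have key : ∀ (α c m0 : ℂ) (m1 n f g : ℝ → ℂ), Continuous m1 → Continuous n → Continuous f →
      Continuous g → (∀ x ∈ Icc (0:ℝ) 1, Q α m0 m1 n f g x = 0) → ∀ x ∈ Icc (0:ℝ) 1,
      Q α m0 m1 n (fun y => α * c + ∫ t in (0:ℝ)..y, (f t + c * n t)) (TG c m0 m1 g) x = 0 := by
    intro α c m0 m1 n f g hm1 hn hf hg h x hx
    have := inv_lemma α c m0 hm1 hn hf hg hx.1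
    unfold Q
    unfold TG
    rw [this, intervalIntegral.integral_congr (g := fun _ => (0:ℂ))]
    · simp
    · intro y hy
      rw [uIcc_of_le hx.1] at hy
      exact h y ⟨hy.1, hy.2.trans hx.2⟩
  constructor
  · intro x hx
    have := key 1 c m0 m1 (ng n) f g hm1 (ng_cont hn) hf hg h1 x hx
    convert this using 2
    funext y
    simp [TF, ng, sub_eq_add_neg]
  · intro x hx
    have := key a (-c) _ _ _ _ _ (ng_cont (rf_cont hm1)) (rf_cont hn) (rf_cont hf) (rf_cont hg) h3 x hx
    rw [← neg_eq_zero, ← Q_neg] at this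
    rw [← this]
    congr 1
    · funext y
      have e := int_split (f := fun t => f t - c * n t) (by fun_prop) y
      have e2 : ∫ t in (0:ℝ)..1, (f t - c * n t) = (∫ t in (0:ℝ)..1, f t) - c * ∫ t in (0:ℝ)..1, n t := by
        rw [intervalIntegral.integral_sub, intervalIntegral.integral_const_mul]
        · exact hf.intervalIntegrable _ _
        · exact Continuous.intervalIntegrable (by fun_prop) _ _
      simp only [rf, TF, ng, e, e2]
      have : ∀ t, f (1 - t) + -c * n (1 - t) = f (1-t) - c * n (1-t) := by intro t; ring
      simp only [this]
      linear_combination hc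
    · funext y
      simp only [rf, TG, ng, intervalIntegral.integral_neg]
      have e1 := int_split hg y
      have e2 := int_split hm1 y
      simp only [rf] at e1 e2
      rw [e1, e2, hg0]
      ring

lemma prim_deriv {k : ℝ → ℂ} (hk : Continuous k) (x : ℝ) :
    HasDerivAt (fun x => ∫ t in (0:ℝ)..x, k t) (k x) x :=
  intervalIntegral.integral_hasDerivAt_right (hk.intervalIntegrable _ _)
    hk.stronglyMeasurable.stronglyMeasurableAtFilter hk.continuousAt

/-- ODE identity. -/
lemma exp_int {k p : ℝ → ℂ} (hk : Continuous k) (hp : Continuous p) (P0 σ : ℂ)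
    (h : ∀ x ∈ Icc (0:ℝ) 1, k x = σ * (P0 + ∫ t in (0:ℝ)..x, k t) + p x) {x : ℝ} (hx : x ∈ Icc (0:ℝ) 1) :
    Complex.exp (-(x:ℂ) * σ) * (P0 + ∫ t in (0:ℝ)..x, k t) - P0
      = ∫ t in (0:ℝ)..x, p t * Complex.exp (-(t:ℂ) * σ) := by
  have hd : ∀ t ∈ uIcc 0 x, HasDerivAt
      (fun x : ℝ => Complex.exp (-(x:ℂ) * σ) * (P0 + ∫ t in (0:ℝ)..x, k t))
      (p t * Complex.exp (-(t:ℂ) * σ)) t := by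
    intro t ht
    rw [uIcc_of_le hx.1] at ht
    have ht' : t ∈ Icc (0:ℝ) 1 := ⟨ht.1, ht.2.trans hx.2⟩
    have e1 : HasDerivAt (fun x : ℝ => -(x:ℂ) * σ) (-1 * σ) t :=
      (Complex.ofRealCLM.hasDerivAt.neg).mul_const σ
    have := e1.cexp.mul ((prim_deriv hk t).const_add P0)
    refine HasDerivAt.congr_deriv (f := fun x : ℝ => Complex.exp (-(x:ℂ) * σ) * (P0 + ∫ t in (0:ℝ)..x, k t)) this ?_
    have := h t ht'
    linear_combination Complex.exp (-(t:ℂ) * σ) * this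
  have := intervalIntegral.integral_eq_sub_of_hasDerivAt hd
    (Continuous.intervalIntegrable (by fun_prop) _ _)
  rw [this]; simp

lemma eig_zero {f : ℝ → ℂ} (hf : Continuous f) (l : ℂ)
    (h : ∀ x ∈ Icc (0:ℝ) 1, ∫ t in (0:ℝ)..x, f t = l * f x) : ∀ x ∈ Icc (0:ℝ) 1, f x = 0 := by
  -- the primitive vanishes
  have hP : ∀ x ∈ Icc (0:ℝ) 1, ∫ t in (0:ℝ)..x, f t = 0 := by
    by_cases hl : l = 0
    · intro x hx; rw [h x hx, hl, zero_mul]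
    · intro x hx
      have := exp_int hf (continuous_const (y := (0:ℂ))) 0 l⁻¹ (by
        intro y hy
        rw [zero_add, h y hy]; field_simp; simp) hx
      simpa using this
  by_cases hl : l = 0
  · have hd : ∀ x ∈ Ioo (0:ℝ) 1, f x = 0 := by
      intro x hx
      have h1 := prim_deriv hf x
      have h2 : HasDerivAt (fun x => ∫ t in (0:ℝ)..x, f t) 0 x := by
        refine (hasDerivAt_const x (0:ℂ)).congr_of_eventuallyEq ?_
        filter_upwards [Ioo_mem_nhds hx.1 hx.2] with y hy
        exact hP y (Ioo_subset_Icc_self hy)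
      exact h1.unique h2
    have hcl : IsClosed {x | f x = 0} := isClosed_eq hf continuous_const
    have := closure_minimal (s := Ioo (0:ℝ) 1) hd hcl
    rw [closure_Ioo (by norm_num)] at this
    exact this
  · intro x hx
    have := h x hx
    rw [hP x hx] at this
    exact (mul_eq_zero.1 this.symm).resolve_left hl

lemma no_eig {a m0 c l : ℂ} {m1 n f g : ℝ → ℂ} (hm1 : Continuous m1) (hn : Continuous n)
    (hf : Continuous f) (hg : Continuous g)
    (hF : 1 - a - (∫ t in (0:ℝ)..1, n t) ≠ 0)
    (hspec : ∀ s : ℂ, ¬ (1 - a * Complex.exp (-s) - (∫ t in (0:ℝ)..1, n t * Complex.exp (-(t:ℂ) * s)) = 0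
      ∧ ∫ t in (0:ℝ)..1, (m0 + ∫ y in (0:ℝ)..t, m1 y) * Complex.exp (-(t:ℂ) * s) = 0))
    (hc : c * (1 - a - (∫ t in (0:ℝ)..1, n t)) = - ∫ t in (0:ℝ)..1, f t)
    (h1 : ∀ x ∈ Icc (0:ℝ) 1, Q 1 m0 m1 (ng n) f g x = 0)
    (h3 : ∀ x ∈ Icc (0:ℝ) 1, Q a (m0 + ∫ t in (0:ℝ)..1, m1 t) (ng (rf m1)) (rf n) (rf f) (rf g) x = 0)
    (hTF : ∀ x ∈ Icc (0:ℝ) 1, TF c n f x = l * f x)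
    (hTG : ∀ x ∈ Icc (0:ℝ) 1, TG c m0 m1 g x = l * g x) :
    (∀ x ∈ Icc (0:ℝ) 1, f x = 0) ∧ (∀ x ∈ Icc (0:ℝ) 1, g x = 0) := by
  by_cases hc0 : c = 0
  · subst hc0
    exact ⟨eig_zero hf l (by simpa [TF] using hTF), eig_zero hg l (by simpa [TG] using hTG)⟩
  exfalso
  have hg0 := intg_zero hm1 hn hf hg hF h1 h3
  have hl : l ≠ 0 := by
    rintro rfl
    have := hTF 0 (by simp)
    simp [TF] at this
    exact hc0 this
  have hone : (1:ℝ) ∈ Icc (0:ℝ) 1 := by simp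
  have e1 : TF c n f 1 = a * c := by
    unfold TF
    rw [intervalIntegral.integral_sub, intervalIntegral.integral_const_mul]
    · linear_combination hc
    · exact hf.intervalIntegrable _ _
    · exact Continuous.intervalIntegrable (by fun_prop) _ _
  apply hspec l⁻¹
  constructor
  · have := exp_int (k := fun t => f t - c * n t) (p := fun t => - c * n t) (by fun_prop) (by fun_prop) c l⁻¹ (by
      intro x hx
      have := hTF x hx
      unfold TF at this
      rw [this]; field_simp; ring) hone
    unfold TF at e1
    rw [e1] at this
    simp only [mul_assoc, intervalIntegral.integral_const_mul] at this
    have h2 : c * (1 - a * Complex.exp (-l⁻¹) - (∫ t in (0:ℝ)..1, n t * Complex.exp (-(t:ℂ) * l⁻¹))) = 0 := by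
      simp only [Complex.ofReal_one, neg_mul, one_mul] at this ⊢
      linear_combination -this
    exact (mul_eq_zero.1 h2).resolve_left hc0
  · have hm := prim_cont hm1
    have := exp_int (k := g) (p := fun t => (- l⁻¹ * c) * (m0 + ∫ y in (0:ℝ)..t, m1 y)) hg (by fun_prop) 0 l⁻¹ (by
      intro x hx
      have := hTG x hx
      unfold TG at this
      have h2 : g x = l⁻¹ * (l * g x) := by field_simp
      rw [h2, ← this]; ring) hone
    rw [hg0] at this
    simp only [mul_assoc (-l⁻¹ * c), intervalIntegral.integral_const_mul] at this
    simp only [add_zero, mul_zero, sub_zero] at this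
    have h2 := (mul_eq_zero.1 this.symm).resolve_left (by simp [hc0, hl])
    exact h2

abbrev EE := BoundedContinuousFunction (Icc (0:ℝ) 1) ℂ

def ex (f : EE) : ℝ → ℂ := IccExtend zero_le_one f

lemma ex_cont (f : EE) : Continuous (ex f) := f.continuous.Icc_extend' 

lemma ex_apply (f : EE) {x : ℝ} (hx : x ∈ Icc (0:ℝ) 1) : ex f x = f ⟨x, hx⟩ :=
  IccExtend_of_mem zero_le_one f hx

lemma ex_norm (f : EE) (x : ℝ) : ‖ex f x‖ ≤ ‖f‖ := f.norm_coe_le_norm _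

def mkE (f : ℝ → ℂ) (hf : Continuous f) : EE :=
  BoundedContinuousFunction.mkOfCompact ⟨fun x => f x, hf.comp continuous_subtype_val⟩

@[simp] lemma mkE_apply (f : ℝ → ℂ) (hf : Continuous f) (x : Icc (0:ℝ) 1) : mkE f hf x = f x := rfl

lemma ex_mkE (f : ℝ → ℂ) (hf : Continuous f) {x : ℝ} (hx : x ∈ Icc (0:ℝ) 1) : ex (mkE f hf) x = f x := by
  rw [ex_apply _ hx]; rfl

def V (k : ℝ → ℂ) (hk : Continuous k) : EE →L[ℂ] EE :=
  LinearMap.mkContinuousOfExistsBound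
    { toFun := fun f => mkE (cv (ex f) k) (cv_cont (ex_cont f) hk)
      map_add' := by
        intro f g
        ext x
        exact cv_add_left (ex_cont f) (ex_cont g) hk x
      map_smul' := by
        intro c f
        ext x
        exact cv_smul_left c (ex f) k x }
    (by
      obtain ⟨B, hB⟩ := (isCompact_Icc (a := (0:ℝ)) (b := 1)).exists_bound_of_continuousOn hk.continuousOn
      have hB0 : 0 ≤ B := (norm_nonneg _).trans (hB 0 (by simp))
      refine ⟨B, fun f => ?_⟩
      rw [BoundedContinuousFunction.norm_le (by positivity)]
      intro x
      have h1 : ‖∫ t in (0:ℝ)..x, ex f t * k (x - t)‖ ≤ (B * ‖f‖) * |(x:ℝ) - 0| := by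
        apply intervalIntegral.norm_integral_le_of_norm_le_const
        intro t ht
        rw [uIoc_of_le x.2.1] at ht
        rw [norm_mul, mul_comm]
        have := x.2.2
        exact mul_le_mul (hB _ ⟨by linarith [ht.2], by linarith [ht.1]⟩) (ex_norm f t) (norm_nonneg _) hB0
      have h2 : |(x:ℝ) - 0| ≤ 1 := by
        rw [sub_zero, abs_of_nonneg x.2.1]; exact x.2.2
      calc _ ≤ (B * ‖f‖) * |(x:ℝ) - 0| := h1
        _ ≤ B * ‖f‖ := mul_le_of_le_one_right (by positivity) h2)

lemma V_apply (k : ℝ → ℂ) (hk : Continuous k) (f : EE) (x : Icc (0:ℝ) 1) : V k hk f x = cv (ex f) k x := rfl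

def V1 : EE →L[ℂ] EE := V (fun _ => 1) continuous_const

lemma V1_apply (f : EE) (x : Icc (0:ℝ) 1) : V1 f x = ∫ t in (0:ℝ)..x, ex f t := by
  rw [V1, V_apply, cv]; simp

lemma V1_compact : IsCompactOperator V1 := by
  refine (isCompactOperator_iff_isCompact_closure_image_closedBall V1.toLinearMap one_pos).2 ?_
  refine BoundedContinuousFunction.arzela_ascoli (Metric.closedBall (0:ℂ) ‖V1‖) (isCompact_closedBall _ _) _ ?_ ?_
  · rintro _ x ⟨f, hf, rfl⟩
    rw [mem_closedBall_zero_iff] at hf ⊢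
    refine (BoundedContinuousFunction.norm_coe_le_norm _ x).trans ?_
    refine (V1.le_opNorm f).trans ?_
    exact mul_le_of_le_one_right (norm_nonneg _) hf
  · have hl : ∀ u : V1.toLinearMap '' Metric.closedBall (0:EE) 1, LipschitzWith 1 (u : Icc (0:ℝ) 1 → ℂ) := by
      rintro ⟨_, f, hf, rfl⟩
      rw [mem_closedBall_zero_iff] at hf
      refine LipschitzWith.of_dist_le_mul fun x y => ?_
      have e : V1 f x - V1 f y = ∫ t in (y:ℝ)..x, ex f t := by
        rw [V1_apply, V1_apply, intervalIntegral.integral_interval_sub_left]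
        · exact (ex_cont f).intervalIntegrable _ _
        · exact (ex_cont f).intervalIntegrable _ _
      change dist (V1 f x) (V1 f y) ≤ _
      rw [dist_eq_norm, e]
      refine (intervalIntegral.norm_integral_le_of_norm_le_const (C := 1)
        (fun t _ => (ex_norm f t).trans hf)).trans ?_
      simp [Subtype.dist_eq, Real.dist_eq]
    exact (LipschitzWith.uniformEquicontinuous _ 1 hl).equicontinuous

lemma V_compact (k : ℝ → ℂ) (hk : Continuous k) (k0 : ℂ) (k1 : ℝ → ℂ) (hk1 : Continuous k1)
    (h : ∀ x ∈ Icc (0:ℝ) 1, k x = k0 + ∫ t in (0:ℝ)..x, k1 t) : IsCompactOperator (V k hk) := by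
  have e : (V k hk : EE → EE) = V1 ∘ (k0 • ContinuousLinearMap.id ℂ EE + V k1 hk1) := by
    funext f
    ext x
    rw [V_apply, cv_congr (fun _ _ => rfl) h x.2, cv_prim k0 (ex_cont f) hk1 x.2.1]
    simp only [Function.comp]
    rw [V1_apply]
    apply intervalIntegral.integral_congr
    intro y hy
    rw [uIcc_of_le x.2.1] at hy
    have hy' : y ∈ Icc (0:ℝ) 1 := ⟨hy.1, hy.2.trans x.2.2⟩
    simp only
    rw [ex_apply _ hy', ex_apply _ hy']
    rfl
  rw [e]
  exact V1_compact.comp_clm _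

def RR : EE →L[ℂ] EE :=
  LinearMap.mkContinuous
    { toFun := fun f => mkE (rf (ex f)) (rf_cont (ex_cont f))
      map_add' := by intro f g; rfl
      map_smul' := by intro c f; rfl } 1
    (by
      intro f
      rw [one_mul, BoundedContinuousFunction.norm_le (norm_nonneg _)]
      intro x
      exact ex_norm f _)

lemma RR_apply (f : EE) (x : Icc (0:ℝ) 1) : RR f x = ex f (1 - x) := rfl

lemma ex_RR (f : EE) {x : ℝ} (hx : x ∈ Icc (0:ℝ) 1) : ex (RR f) x = rf (ex f) x := by
  rw [ex_apply _ hx]; rfl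

lemma one_sub_mem {x : ℝ} (hx : x ∈ Icc (0:ℝ) 1) : 1 - x ∈ Icc (0:ℝ) 1 := by
  constructor <;> linarith [hx.1, hx.2]

lemma core {a m0 : ℂ} {m1 m2 n n1 : ℝ → ℂ} (hm2 : Continuous m2) (hn1 : Continuous n1)
    (hm1 : ∀ x, m1 x = m1 0 + ∫ t in (0:ℝ)..x, m2 t) (hn : ∀ x, n x = n 0 + ∫ t in (0:ℝ)..x, n1 t)
    (hd : a * m0 - (m0 + ∫ t in (0:ℝ)..1, m1 t) ≠ 0)
    (hF : 1 - a - (∫ t in (0:ℝ)..1, n t) ≠ 0)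
    (hspec : ∀ s : ℂ, ¬ (1 - a * Complex.exp (-s) - (∫ t in (0:ℝ)..1, n t * Complex.exp (-(t:ℂ) * s)) = 0
      ∧ ∫ t in (0:ℝ)..1, (m0 + ∫ y in (0:ℝ)..t, m1 y) * Complex.exp (-(t:ℂ) * s) = 0)) :
    (∀ f g : ℝ → ℂ, Continuous f → Continuous g →
      (∀ x ∈ Icc (0:ℝ) 1, Q 1 m0 m1 (ng n) f g x = 0) →
      (∀ x ∈ Icc (0:ℝ) 1, Q a (m0 + ∫ t in (0:ℝ)..1, m1 t) (ng (rf m1)) (rf n) (rf f) (rf g) x = 0) →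
      (∀ x ∈ Icc (0:ℝ) 1, f x = 0) ∧ (∀ x ∈ Icc (0:ℝ) 1, g x = 0)) ∧
    (∀ h : ℝ → ℂ, Continuous h → ∃ f g : ℝ → ℂ, Continuous f ∧ Continuous g ∧
      (∀ x ∈ Icc (0:ℝ) 1, Q 1 m0 m1 (ng n) f g x = h x) ∧
      (∀ x ∈ Icc (0:ℝ) 1, Q a (m0 + ∫ t in (0:ℝ)..1, m1 t) (ng (rf m1)) (rf n) (rf f) (rf g) x = 0)) := by
  have hm1c : Continuous m1 := by
    rw [funext hm1]; exact continuous_const.add (prim_cont hm2)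
  have hnc : Continuous n := by
    rw [funext hn]; exact continuous_const.add (prim_cont hn1)
  set mE := m0 + ∫ t in (0:ℝ)..1, m1 t with hmE
  set d := a * m0 - mE with hdd
  -- compact pieces
  let A1 := V m1 hm1c
  let A2 := V (ng n) (ng_cont hnc)
  let B1 := V (ng (rf m1)) (ng_cont (rf_cont hm1c))
  let B2 := V (rf n) (rf_cont hnc)
  have hrf : ∀ k k1 : ℝ → ℂ, Continuous k1 → (∀ x, k x = k 0 + ∫ t in (0:ℝ)..x, k1 t) →
      ∀ x, rf k x = k 1 + ∫ t in (0:ℝ)..x, ng (rf k1) t := by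
    intro k k1 hk1 hk x
    have e := int_split hk1 x
    have h1 := hk (1 - x)
    have h2 := hk 1
    simp only [ng, intervalIntegral.integral_neg]
    simp only [rf] at e ⊢
    rw [h1, h2, e]; ring
  have cA1 : IsCompactOperator A1 := V_compact _ _ _ _ hm2 (fun x _ => hm1 x)
  have cA2 : IsCompactOperator A2 := V_compact _ _ (- n 0) (ng n1) (ng_cont hn1) (fun x _ => by
    simp only [ng, intervalIntegral.integral_neg]; rw [hn x]; ring)
  have cB1 : IsCompactOperator B1 := V_compact _ _ (- m1 1) (rf m2) (rf_cont hm2) (fun x _ => by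
    rw [ng, hrf m1 m2 hm2 hm1 x]; simp only [ng, intervalIntegral.integral_neg]; ring)
  have cB2 : IsCompactOperator B2 := V_compact _ _ (n 1) (ng (rf n1)) (ng_cont (rf_cont hn1))
    (fun x _ => hrf n n1 hn1 hn x)
  let fs := ContinuousLinearMap.fst ℂ EE EE
  let sn := ContinuousLinearMap.snd ℂ EE EE
  let k1 : EE × EE →L[ℂ] EE := A1.comp fs + A2.comp sn
  let k3 : EE × EE →L[ℂ] EE := RR.comp (B1.comp (RR.comp fs) + B2.comp (RR.comp sn))
  have ck1 : IsCompactOperator k1 := (cA1.comp_clm fs).add (cA2.comp_clm sn)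
  have ck3 : IsCompactOperator k3 :=
    ((cB1.comp_clm (RR.comp fs)).add (cB2.comp_clm (RR.comp sn))).clm_comp RR
  let p : EE × EE →L[ℂ] EE := (-d⁻¹) • (a • k1 - k3)
  let q : EE × EE →L[ℂ] EE := (-k1) - m0 • p
  have cp : IsCompactOperator p := ((ck1.smul a).sub ck3).smul (-d⁻¹)
  have cq : IsCompactOperator q := ck1.neg.sub (cp.smul m0)
  let C : EE × EE →L[ℂ] EE × EE :=
    (ContinuousLinearMap.inl ℂ EE EE).comp p + (ContinuousLinearMap.inr ℂ EE EE).comp q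
  have cC : IsCompactOperator C := (cp.clm_comp (ContinuousLinearMap.inl ℂ EE EE)).add
    (cq.clm_comp (ContinuousLinearMap.inr ℂ EE EE))
  have C1 : ∀ w, (C w).1 = p w := fun w => by simp [C]
  have C2 : ∀ w, (C w).2 = q w := fun w => by simp [C]
  have k1a : ∀ (w : EE × EE) (x : Icc (0:ℝ) 1), k1 w x = cv (ex w.1) m1 x + cv (ex w.2) (ng n) x :=
    fun w x => rfl
  have k3a : ∀ (w : EE × EE) (x : Icc (0:ℝ) 1), k3 w x
      = cv (rf (ex w.1)) (ng (rf m1)) (1 - x) + cv (rf (ex w.2)) (rf n) (1 - x) := by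
    intro w x
    have hx := one_sub_mem x.2
    change ex (B1 (RR w.1) + B2 (RR w.2)) (1 - x) = _
    rw [ex_apply _ hx, ← cv_congr (fun _ h => ex_RR w.1 h) (fun _ _ => rfl) hx,
      ← cv_congr (fun _ h => ex_RR w.2 h) (fun _ _ => rfl) hx]
    rfl
  have pa : ∀ (w : EE × EE) (x : Icc (0:ℝ) 1), p w x = -d⁻¹ * (a * k1 w x - k3 w x) := fun _ _ => rfl
  have qa : ∀ (w : EE × EE) (x : Icc (0:ℝ) 1), q w x = - k1 w x - m0 * p w x := fun _ _ => rfl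
  -- the equivalence
  have key : ∀ (w : EE × EE) (h : ℝ → ℂ) (hh : Continuous h),
      (w - C w = ((a * d⁻¹) • mkE h hh, (1 - m0 * a * d⁻¹) • mkE h hh)) ↔
      ((∀ x ∈ Icc (0:ℝ) 1, Q 1 m0 m1 (ng n) (ex w.1) (ex w.2) x = h x) ∧
      (∀ x ∈ Icc (0:ℝ) 1, Q a mE (ng (rf m1)) (rf n) (rf (ex w.1)) (rf (ex w.2)) x = 0)) := by
    intro w h hh
    have q1 : ∀ x : Icc (0:ℝ) 1, Q 1 m0 m1 (ng n) (ex w.1) (ex w.2) x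
        = w.2 x + m0 * w.1 x + k1 w x := by
      intro x
      rw [k1a, Q, ex_apply _ x.2, ex_apply _ x.2]; ring
    have q3 : ∀ x : Icc (0:ℝ) 1, Q a mE (ng (rf m1)) (rf n) (rf (ex w.1)) (rf (ex w.2)) (1 - x)
        = a * w.2 x + mE * w.1 x + k3 w x := by
      intro x
      have e : ∀ f : EE, rf (ex f) (1 - x) = f x := by
        intro f
        rw [rf, sub_sub_cancel, ex_apply _ x.2]
      rw [k3a, Q, e, e]; ring
    constructor
    · intro H
      have H1 : ∀ x : Icc (0:ℝ) 1, w.1 x - p w x = a * d⁻¹ * h x := by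
        intro x
        have := congrArg (fun z : EE × EE => z.1 x) H
        simp only [Prod.fst_sub, C1] at this
        exact this
      have H2 : ∀ x : Icc (0:ℝ) 1, w.2 x - q w x = (1 - m0 * a * d⁻¹) * h x := by
        intro x
        have := congrArg (fun z : EE × EE => z.2 x) H
        simp only [Prod.snd_sub, C2] at this
        exact this
      constructor
      · intro x hx
        have h1 := H1 ⟨x, hx⟩
        have h2 := H2 ⟨x, hx⟩
        rw [qa] at h2
        rw [q1 ⟨x, hx⟩]
        linear_combination h2 + m0 * h1
      · intro x hx
        have hx' := one_sub_mem hx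
        have := q3 ⟨1 - x, hx'⟩
        simp only [sub_sub_cancel] at this
        rw [this]
        have h1 := H1 ⟨1 - x, hx'⟩
        have h2 := H2 ⟨1 - x, hx'⟩
        rw [qa] at h2
        rw [pa] at h1 h2
        have hdi : d * d⁻¹ = 1 := mul_inv_cancel₀ hd
        generalize d⁻¹ = di at *
        rw [hdd] at hdi
        linear_combination a * h2 + mE * h1 + (h (1 - x) * a - (a * k1 w ⟨1 - x, hx'⟩ - k3 w ⟨1 - x, hx'⟩)) * (-hdi)
    · rintro ⟨H1, H2⟩
      have hdi : d * d⁻¹ = 1 := mul_inv_cancel₀ hd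
      have E1 : ∀ x : Icc (0:ℝ) 1, w.1 x - p w x = a * d⁻¹ * h x := by
        intro x
        have h1 := H1 x x.2
        have h2 := H2 (1 - x) (one_sub_mem x.2)
        rw [q1] at h1
        rw [q3] at h2
        rw [pa]
        generalize d⁻¹ = di at *
        rw [hdd] at hdi
        linear_combination a * di * h1 - di * h2 - hdi * w.1 x
      have E2 : ∀ x : Icc (0:ℝ) 1, w.2 x - q w x = (1 - m0 * a * d⁻¹) * h x := by
        intro x
        have h1 := H1 x x.2
        rw [q1] at h1
        rw [qa]
        linear_combination h1 - m0 * E1 x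
      apply Prod.ext
      · ext x
        rw [Prod.fst_sub, C1]; exact E1 x
      · ext x
        rw [Prod.snd_sub, C2]; exact E2 x
  have key0 : ∀ w : EE × EE, C w = w ↔
      ((∀ x ∈ Icc (0:ℝ) 1, Q 1 m0 m1 (ng n) (ex w.1) (ex w.2) x = 0) ∧
      (∀ x ∈ Icc (0:ℝ) 1, Q a mE (ng (rf m1)) (rf n) (rf (ex w.1)) (rf (ex w.2)) x = 0)) := by
    intro w
    rw [← key w (fun _ => 0) continuous_const]
    have : mkE (fun _ => 0) continuous_const = 0 := rfl
    rw [this, smul_zero, smul_zero, ← Prod.zero_eq_mk, sub_eq_zero, eq_comm]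
  have rf_ex : ∀ {f g : ℝ → ℂ}, (∀ x ∈ Icc (0:ℝ) 1, f x = g x) → ∀ x ∈ Icc (0:ℝ) 1, rf f x = rf g x :=
    fun h x hx => h _ (one_sub_mem hx)
  -- the operator T
  let F00 := 1 - a - (∫ t in (0:ℝ)..1, n t)
  let one : Icc (0:ℝ) 1 := ⟨1, by simp⟩
  let cL : EE × EE →ₗ[ℂ] ℂ :=
    { toFun := fun w => - F00⁻¹ * V1 w.1 one
      map_add' := by intro u v; simp [mul_add]
      map_smul' := by intro c u; simp; ring }
  have hcL : ∀ w, cL w * F00 = - ∫ t in (0:ℝ)..1, ex w.1 t := by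
    intro w
    have : cL w = - F00⁻¹ * ∫ t in (0:ℝ)..1, ex w.1 t := by
      change - F00⁻¹ * V1 w.1 one = _
      rw [V1_apply]
    rw [this]
    have : F00 ≠ 0 := hF
    field_simp
  let U : EE := mkE (fun x => 1 - ∫ t in (0:ℝ)..x, n t) (continuous_const.sub (prim_cont hnc))
  let M : EE := mkE (fun x => m0 + ∫ t in (0:ℝ)..x, m1 t) (continuous_const.add (prim_cont hm1c))
  let T : EE × EE →ₗ[ℂ] EE × EE :=
    LinearMap.prod (cL.smulRight U + V1.toLinearMap ∘ₗ LinearMap.fst ℂ EE EE)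
      (cL.smulRight (-M) + V1.toLinearMap ∘ₗ LinearMap.snd ℂ EE EE)
  have T1 : ∀ w, ∀ x ∈ Icc (0:ℝ) 1, ex (T w).1 x = TF (cL w) n (ex w.1) x := by
    intro w x hx
    rw [ex_apply _ hx]
    change cL w * (1 - ∫ t in (0:ℝ)..x, n t) + V1 w.1 ⟨x, hx⟩ = _
    rw [V1_apply, TF, intervalIntegral.integral_sub, intervalIntegral.integral_const_mul]
    · ring
    · exact (ex_cont _).intervalIntegrable _ _
    · exact Continuous.intervalIntegrable (by fun_prop) _ _
  have T2 : ∀ w, ∀ x ∈ Icc (0:ℝ) 1, ex (T w).2 x = TG (cL w) m0 m1 (ex w.2) x := by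
    intro w x hx
    rw [ex_apply _ hx]
    change cL w * -(m0 + ∫ t in (0:ℝ)..x, m1 t) + V1 w.2 ⟨x, hx⟩ = _
    rw [V1_apply, TG]
    ring
  obtain ⟨hinj, hsurj⟩ := fred C cC T (by
      intro w hw
      rw [key0] at hw ⊢
      obtain ⟨r1, r2⟩ := Q_inv hm1c hnc (ex_cont w.1) (ex_cont w.2) hF (hcL w) hw.1 hw.2
      constructor
      · intro x hx
        rw [Q_congr (T1 w) (T2 w) hx]; exact r1 x hx
      · intro x hx
        rw [Q_congr (rf_ex (T1 w)) (rf_ex (T2 w)) hx]; exact r2 x hx) (by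
      intro w l hw hl
      rw [key0] at hw
      obtain ⟨r1, r2⟩ := no_eig (l := l) hm1c hnc (ex_cont w.1) (ex_cont w.2) hF hspec (hcL w) hw.1 hw.2 (by
          intro x hx
          rw [← T1 w x hx, hl]; rfl) (by
          intro x hx
          rw [← T2 w x hx, hl]; rfl)
      apply Prod.ext
      · ext x
        have := r1 x x.2
        rw [ex_apply _ x.2] at this
        exact this
      · ext x
        have := r2 x x.2
        rw [ex_apply _ x.2] at this
        exact this)
  constructor
  · intro f g hf hg h1 h3
    have ef : ∀ x ∈ Icc (0:ℝ) 1, ex (mkE f hf) x = f x := fun x hx => ex_mkE f hf hx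
    have eg : ∀ x ∈ Icc (0:ℝ) 1, ex (mkE g hg) x = g x := fun x hx => ex_mkE g hg hx
    have := hinj (mkE f hf, mkE g hg) (by
      rw [key0]
      constructor
      · intro x hx
        rw [Q_congr ef eg hx]; exact h1 x hx
      · intro x hx
        rw [Q_congr (rf_ex ef) (rf_ex eg) hx]; exact h3 x hx)
    constructor
    · intro x hx
      exact congrArg (fun z : EE × EE => z.1 ⟨x, hx⟩) this
    · intro x hx
      exact congrArg (fun z : EE × EE => z.2 ⟨x, hx⟩) this
  · intro h hh
    obtain ⟨w, hw⟩ := hsurj ((a * d⁻¹) • mkE h hh, (1 - m0 * a * d⁻¹) • mkE h hh)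
    rw [key w h hh] at hw
    exact ⟨ex w.1, ex w.2, ex_cont _, ex_cont _, hw.1, hw.2⟩

def oR (f : ℝ → ℝ) (x : ℝ) : ℂ := (f x : ℂ)

lemma oR_cont {f : ℝ → ℝ} (hf : Continuous f) : Continuous (oR f) := by
  unfold oR; fun_prop

lemma oR_prim {k k1 : ℝ → ℝ} (h : ∀ x, k x = k 0 + ∫ t in (0:ℝ)..x, k1 t) (x : ℝ) :
    oR k x = oR k 0 + ∫ t in (0:ℝ)..x, oR k1 t := by
  unfold oR
  rw [intervalIntegral.integral_ofReal, ← Complex.ofReal_add, ← h x]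

lemma cv_re {F : ℝ → ℂ} {k : ℝ → ℝ} (hF : Continuous F) (hk : Continuous k) (x : ℝ) :
    cv (oR fun t => (F t).re) (oR k) x = ((cv F (oR k) x).re : ℂ) := by
  have hk' := oR_cont hk
  have := Complex.reCLM.intervalIntegral_comp_comm (μ := volume) (a := 0) (b := x) (f := fun t => F t * oR k (x - t))
    (Continuous.intervalIntegrable (by fun_prop) _ _)
  simp only [Complex.reCLM_apply] at this
  unfold cv
  rw [← this, ← intervalIntegral.integral_ofReal]
  apply intervalIntegral.integral_congr
  intro t _
  simp [oR]

lemma Q_re {α m0 : ℝ} {m1 n : ℝ → ℝ} {F G : ℝ → ℂ} (hm1 : Continuous m1) (hn : Continuous n)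
    (hF : Continuous F) (hG : Continuous G) (x : ℝ) :
    Q α m0 (oR m1) (oR n) (oR fun t => (F t).re) (oR fun t => (G t).re) x
      = ((Q α m0 (oR m1) (oR n) F G x).re : ℂ) := by
  unfold Q
  rw [cv_re hF hm1, cv_re hG hn]
  simp [oR]

lemma prim_contDiff {k : ℝ → ℂ} (hk : Continuous k) : ContDiff ℝ 1 (fun x => ∫ t in (0:ℝ)..x, k t) := by
  rw [contDiff_one_iff_deriv]
  refine ⟨fun x => (prim_deriv hk x).differentiableAt, ?_⟩
  have : deriv (fun x => ∫ t in (0:ℝ)..x, k t) = k := funext fun x => (prim_deriv hk x).deriv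
  rw [this]; exact hk

lemma cv_contDiff {f k k1 : ℝ → ℂ} (hf : Continuous f) (hk1 : Continuous k1) (k0 : ℂ)
    (h : ∀ x ∈ Icc (0:ℝ) 1, k x = k0 + ∫ t in (0:ℝ)..x, k1 t) :
    ContDiffOn ℝ 1 (cv f k) (Icc 0 1) := by
  have hc : Continuous fun y => k0 * f y + cv f k1 y := by
    have := cv_cont hf hk1
    fun_prop
  refine (prim_contDiff hc).contDiffOn.congr fun x hx => ?_
  rw [cv_congr (fun _ _ => rfl) h hx, cv_prim k0 hf hk1 hx.1]

lemma ext1 {k : ℝ → ℝ} (hk : ContDiffOn ℝ 1 k (Icc 0 1)) :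
    ∃ k1 : ℝ → ℝ, Continuous k1 ∧ (∀ x ∈ Icc (0:ℝ) 1, k1 x = derivWithin k (Icc 0 1) x) ∧
      ∀ x ∈ Icc (0:ℝ) 1, k x = k 0 + ∫ t in (0:ℝ)..x, k1 t := by
  have hc : ContinuousOn (derivWithin k (Icc 0 1)) (Icc 0 1) :=
    hk.continuousOn_derivWithin (uniqueDiffOn_Icc zero_lt_one) le_rfl
  have hcc : Continuous (IccExtend (zero_le_one (α := ℝ)) ((Icc (0:ℝ) 1).restrict (derivWithin k (Icc 0 1)))) :=
    (continuousOn_iff_continuous_restrict.1 hc).Icc_extend'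
  refine ⟨_, hcc, fun x hx => IccExtend_of_mem _ _ hx, fun x hx => ?_⟩
  rw [intervalIntegral.integral_eq_sub_of_hasDerivAt_of_le hx.1 (f := k)
    (hk.continuousOn.mono (Icc_subset_Icc le_rfl hx.2)) _ (hcc.intervalIntegrable _ _)]
  · ring
  · intro t ht
    have ht' : t ∈ Ioo (0:ℝ) 1 := ⟨ht.1, ht.2.trans_le hx.2⟩
    rw [IccExtend_of_mem _ _ (Ioo_subset_Icc_self ht')]
    exact ((hk.differentiableOn one_ne_zero) t (Ioo_subset_Icc_self ht')).hasDerivWithinAt.hasDerivAt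
      (Icc_mem_nhds ht'.1 ht'.2)

lemma J1Q {M N mr nr : ℝ → ℝ} (hmr : ∀ x ∈ Ioo (0:ℝ) 1, deriv M x = mr x)
    (hnr : ∀ x ∈ Icc (0:ℝ) 1, N x = nr x) (f g : ℝ → ℝ) {x : ℝ} (hx : x ∈ Icc (0:ℝ) 1) :
    (J1 M N f g x : ℂ) = Q 1 (M 0 : ℝ) (oR mr) (ng (oR nr)) (oR f) (oR g) x + oR nr x := by
  have e1 : ((∫ η in (0:ℝ)..x, f η * deriv M (x - η) : ℝ) : ℂ) = cv (oR f) (oR mr) x := by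
    rw [← intervalIntegral.integral_ofReal, cv]
    apply intervalIntegral.integral_congr_ae
    have : ∀ᵐ y : ℝ, y ≠ x := by simp [ae_iff]
    filter_upwards [this] with t ht h
    rw [uIoc_of_le hx.1] at h
    have : t < x := lt_of_le_of_ne h.2 ht
    rw [hmr (x - t) ⟨by linarith, by linarith [h.1, hx.2]⟩]
    simp [oR]
  have e2 : ((∫ η in (0:ℝ)..x, g η * N (x - η) : ℝ) : ℂ) = - cv (oR g) (ng (oR nr)) x := by
    rw [← intervalIntegral.integral_ofReal, cv, ← intervalIntegral.integral_neg]
    apply intervalIntegral.integral_congr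
    intro t ht
    rw [uIcc_of_le hx.1] at ht
    simp only
    rw [hnr (x - t) ⟨by linarith [ht.2], by linarith [ht.1, hx.2]⟩]
    simp [oR, ng]
  unfold J1 Q
  push_cast
  rw [e1, e2, hnr x hx]
  simp only [oR]
  ring

lemma J3Q {a : ℝ} {M N mr nr : ℝ → ℝ} (hmr : ∀ x ∈ Ioo (0:ℝ) 1, deriv M x = mr x)
    (hnr : ∀ x ∈ Icc (0:ℝ) 1, N x = nr x) (f g : ℝ → ℝ) {x : ℝ} (hx : x ∈ Icc (0:ℝ) 1) :
    (J3 a M N f g (2 - x) : ℂ)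
      = - Q a (M 1 : ℝ) (ng (rf (oR mr))) (rf (oR nr)) (rf (oR f)) (rf (oR g)) x := by
  have hs : 2 - x - 1 = 1 - x := by ring
  have e1 : ((∫ η in (1 - x)..(1:ℝ), f η * deriv M (2 - x - η) : ℝ) : ℂ)
      = - cv (rf (oR f)) (ng (rf (oR mr))) x := by
    have := intervalIntegral.integral_comp_sub_left (a := 0) (b := x) (fun t => f t * deriv M (2 - x - t)) 1
    rw [sub_zero] at this
    rw [← this, ← intervalIntegral.integral_ofReal, cv, ← intervalIntegral.integral_neg]
    apply intervalIntegral.integral_congr_ae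
    have : ∀ᵐ y : ℝ, y ≠ x := by simp [ae_iff]
    filter_upwards [this] with t ht h
    rw [uIoc_of_le hx.1] at h
    have : t < x := lt_of_le_of_ne h.2 ht
    rw [hmr (2 - x - (1 - t)) ⟨by linarith [h.1, hx.2], by linarith⟩]
    have e : 2 - x - (1 - t) = 1 - (x - t) := by ring
    simp [oR, rf, ng, e]
  have e2 : ((∫ η in (1 - x)..(1:ℝ), g η * N (2 - x - η) : ℝ) : ℂ)
      = cv (rf (oR g)) (rf (oR nr)) x := by
    have := intervalIntegral.integral_comp_sub_left (a := 0) (b := x) (fun t => g t * N (2 - x - t)) 1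
    rw [sub_zero] at this
    rw [← this, ← intervalIntegral.integral_ofReal, cv]
    apply intervalIntegral.integral_congr
    intro t ht
    rw [uIcc_of_le hx.1] at ht
    simp only
    have e : 2 - x - (1 - t) = 1 - (x - t) := by ring
    rw [e, hnr (1 - (x - t)) ⟨by linarith [ht.1, hx.2], by linarith [ht.2]⟩]
    simp [oR, rf]
  unfold J3 Q
  rw [hs]
  push_cast
  rw [e1, e2]
  simp only [oR, rf]
  ring

theorem stmt3
    (a : ℝ) (M N : ℝ → ℝ)
    (ha : -1 < a ∧ a < 1)
    (hspec : ∀ s : ℂ, ¬(F0 a 1 N s = 0 ∧ F1 0 1 M s = 0))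
    (hM : ContDiffOn ℝ 2 M (Set.Icc 0 1)) (hN : ContDiffOn ℝ 2 N (Set.Icc 0 1))
    (hMa : a * M 0 - M 1 ≠ 0) (hF00 : F0 a 1 N 0 ≠ 0) :
    ∃ f g : ℝ → ℝ,
      (ContDiffOn ℝ 1 f (Set.Icc 0 1) ∧ ContDiffOn ℝ 1 g (Set.Icc 0 1) ∧
        (∀ ν ∈ Set.Ico (0:ℝ) 1, J1 M N f g ν = 0) ∧
        (∀ ν ∈ Set.Icc (1:ℝ) 2, J3 a M N f g ν = 0)) ∧
      ∀ f' g' : ℝ → ℝ,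
        (ContDiffOn ℝ 1 f' (Set.Icc 0 1) ∧ ContDiffOn ℝ 1 g' (Set.Icc 0 1) ∧
          (∀ ν ∈ Set.Ico (0:ℝ) 1, J1 M N f' g' ν = 0) ∧
          (∀ ν ∈ Set.Icc (1:ℝ) 2, J3 a M N f' g' ν = 0)) →
        (∀ ν ∈ Set.Icc (0:ℝ) 1, f' ν = f ν) ∧ (∀ ν ∈ Set.Icc (0:ℝ) 1, g' ν = g ν) := by
  -- global extensions
  obtain ⟨k1, hk1c, hk1, hMk⟩ := ext1 (hM.of_le (by norm_num))
  obtain ⟨k2, hk2c, -, hMk2⟩ := ext1 (k := derivWithin M (Icc 0 1))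
    (hM.derivWithin (uniqueDiffOn_Icc zero_lt_one) (by norm_num))
  obtain ⟨n1, hn1c, -, hNk⟩ := ext1 (hN.of_le (by norm_num))
  obtain ⟨mr, hmr⟩ : ∃ mr : ℝ → ℝ, ∀ x, mr x = derivWithin M (Icc 0 1) 0 + ∫ t in (0:ℝ)..x, k2 t := ⟨_, fun _ => rfl⟩
  obtain ⟨nr, hnr⟩ : ∃ nr : ℝ → ℝ, ∀ x, nr x = N 0 + ∫ t in (0:ℝ)..x, n1 t := ⟨_, fun _ => rfl⟩
  have hmr' : ∀ x, mr x = mr 0 + ∫ t in (0:ℝ)..x, k2 t := by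
    intro x; rw [hmr x, hmr 0]; simp
  have hnr' : ∀ x, nr x = nr 0 + ∫ t in (0:ℝ)..x, n1 t := by
    intro x; rw [hnr x, hnr 0]; simp
  have hNn : ∀ x ∈ Icc (0:ℝ) 1, N x = nr x := fun x hx => by rw [hnr, hNk x hx]
  have hMw : ∀ x ∈ Icc (0:ℝ) 1, derivWithin M (Icc 0 1) x = mr x := fun x hx => by rw [hmr, hMk2 x hx]
  have hMd : ∀ x ∈ Ioo (0:ℝ) 1, deriv M x = mr x := by
    intro x hx
    rw [← hMw x (Ioo_subset_Icc_self hx), derivWithin_of_mem_nhds (Icc_mem_nhds hx.1 hx.2)]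
  have hMm : ∀ x ∈ Icc (0:ℝ) 1, (M x : ℂ) = (M 0 : ℝ) + ∫ t in (0:ℝ)..x, oR mr t := by
    intro x hx
    unfold oR
    rw [intervalIntegral.integral_ofReal, ← Complex.ofReal_add, hMk x hx]
    congr 2
    apply intervalIntegral.integral_congr
    intro t ht
    rw [uIcc_of_le hx.1] at ht
    have ht' : t ∈ Icc (0:ℝ) 1 := ⟨ht.1, ht.2.trans hx.2⟩
    rw [hk1 t ht', hMw t ht']
  have hMone := hMm 1 (by simp)
  have hm1 := oR_prim hmr'
  have hn := oR_prim hnr'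
  have hk2C := oR_cont hk2c
  have hn1C := oR_cont hn1c
  have hmrc : Continuous mr := by
    rw [funext hmr]
    exact continuous_const.add (intervalIntegral.continuous_primitive (fun _ _ => hk2c.intervalIntegrable _ _) 0)
  have hnrc : Continuous nr := by
    rw [funext hnr]
    exact continuous_const.add (intervalIntegral.continuous_primitive (fun _ _ => hn1c.intervalIntegrable _ _) 0)
  have hF0 : ∀ s : ℂ, F0 a 1 N s = 1 - a * Complex.exp (-s)
      - (∫ t in (0:ℝ)..1, oR nr t * Complex.exp (-(t:ℂ) * s)) := by
    intro s
    unfold F0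
    congr 1
    · simp
    · apply intervalIntegral.integral_congr
      intro t ht
      rw [uIcc_of_le zero_le_one] at ht
      simp only [oR]
      rw [hNn t ht]
  have hF1 : ∀ s : ℂ, F1 0 1 M s = ∫ t in (0:ℝ)..1, (((M 0 : ℝ) : ℂ) + ∫ y in (0:ℝ)..t, oR mr y) * Complex.exp (-(t:ℂ) * s) := by
    intro s
    unfold F1
    rw [Complex.ofReal_zero, zero_mul, zero_add]
    apply intervalIntegral.integral_congr
    intro t ht
    rw [uIcc_of_le zero_le_one] at ht
    simp only
    rw [hMm t ht]
  have hd : (a:ℂ) * (M 0 : ℝ) - (((M 0 : ℝ) : ℂ) + ∫ t in (0:ℝ)..1, oR mr t) ≠ 0 := by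
    rw [← hMone]; exact_mod_cast hMa
  obtain ⟨huniq, hex⟩ := core (a := (a:ℂ)) (m0 := ((M 0 : ℝ) : ℂ)) hk2C hn1C hm1 hn hd
    (by
      have := hF0 0
      simp only [neg_zero, Complex.exp_zero, mul_zero, mul_one] at this
      rw [← this]; exact hF00)
    (by
      intro s
      rw [← hF0, ← hF1]; exact hspec s)
  rw [← hMone] at huniq hex hd
  obtain ⟨F, G, hFc, hGc, hQ1, hQ3⟩ := hex (fun x => - oR nr x) (oR_cont hnrc).neg
  -- regularity
  have hrf : ∀ k k1 : ℝ → ℂ, Continuous k1 → (∀ x, k x = k 0 + ∫ t in (0:ℝ)..x, k1 t) →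
      ∀ x, rf k x = k 1 + ∫ t in (0:ℝ)..x, ng (rf k1) t := by
    intro k k1 hk1 hk x
    have e := int_split hk1 x
    have h1 := hk (1 - x)
    have h2 := hk 1
    simp only [ng, intervalIntegral.integral_neg]
    simp only [rf] at e ⊢
    rw [h1, h2, e]; ring
  have r1 : ContDiffOn ℝ 1 (cv F (oR mr)) (Icc 0 1) := cv_contDiff hFc hk2C _ (fun x _ => hm1 x)
  have r2 : ContDiffOn ℝ 1 (cv G (ng (oR nr))) (Icc 0 1) :=
    cv_contDiff hGc (ng_cont hn1C) (- oR nr 0) (fun x _ => by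
      simp only [ng, intervalIntegral.integral_neg]; rw [hn x]; ring)
  have r3 : ContDiffOn ℝ 1 (cv (rf F) (ng (rf (oR mr)))) (Icc 0 1) :=
    cv_contDiff (rf_cont hFc) (rf_cont hk2C) (- oR mr 1) (fun x _ => by
      rw [ng, hrf _ _ hk2C hm1 x]; simp only [ng, intervalIntegral.integral_neg]; ring)
  have r4 : ContDiffOn ℝ 1 (cv (rf G) (rf (oR nr))) (Icc 0 1) :=
    cv_contDiff (rf_cont hGc) (ng_cont (rf_cont hn1C)) (oR nr 1) (fun x _ => hrf _ _ hn1C hn x)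
  have hmaps : MapsTo (fun x : ℝ => 1 - x) (Icc 0 1) (Icc 0 1) := fun x hx => one_sub_mem hx
  have hsub : ContDiffOn ℝ 1 (fun x : ℝ => 1 - x) (Icc 0 1) := by fun_prop
  have r3' := r3.comp hsub hmaps
  have r4' := r4.comp hsub hmaps
  have rn : ContDiffOn ℝ 1 (oR nr) (Icc 0 1) := by
    rw [funext hn]; exact (contDiff_const.add (prim_contDiff hn1C)).contDiffOn
  have hFs : ContDiffOn ℝ 1 F (Icc 0 1) := by
    have : ContDiffOn ℝ 1 (fun x => ((a:ℂ) * (M 0 : ℝ) - (M 1 : ℝ))⁻¹ *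
        ((a:ℂ) * (- oR nr x - cv F (oR mr) x - cv G (ng (oR nr)) x)
          + (cv (rf F) (ng (rf (oR mr))) (1 - x) + cv (rf G) (rf (oR nr)) (1 - x)))) (Icc 0 1) :=
      contDiffOn_const.mul ((contDiffOn_const.mul ((rn.neg.sub r1).sub r2)).add (r3'.add r4'))
    refine this.congr fun x hx => ?_
    have h1 := hQ1 x hx
    have h3 := hQ3 (1 - x) (one_sub_mem hx)
    unfold Q at h1 h3
    have e : ∀ f : ℝ → ℂ, rf f (1 - x) = f x := by intro f; rw [rf, sub_sub_cancel]
    rw [e F, e G] at h3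
    rw [eq_inv_mul_iff_mul_eq₀ hd]
    linear_combination a * h1 - h3
  have hGs : ContDiffOn ℝ 1 G (Icc 0 1) := by
    have : ContDiffOn ℝ 1 (fun x => - oR nr x - cv F (oR mr) x - cv G (ng (oR nr)) x - (M 0 : ℝ) * F x) (Icc 0 1) :=
      ((rn.neg.sub r1).sub r2).sub (contDiffOn_const.mul hFs)
    refine this.congr fun x hx => ?_
    have h1 := hQ1 x hx
    unfold Q at h1
    linear_combination h1
  -- the real parts satisfy the complex equations
  have eng : ∀ k : ℝ → ℝ, ng (oR k) = oR (fun x => - k x) := by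
    intro k; funext x; simp [ng, oR]
  have erf : ∀ k : ℝ → ℝ, rf (oR k) = oR (fun x => k (1 - x)) := fun _ => rfl
  have hQ1r : ∀ x ∈ Icc (0:ℝ) 1, Q 1 (M 0 : ℝ) (oR mr) (ng (oR nr)) (oR fun t => (F t).re)
      (oR fun t => (G t).re) x = - oR nr x := by
    intro x hx
    have := Q_re (α := 1) (m0 := M 0) (n := fun x => - nr x) hmrc hnrc.neg hFc hGc x
    rw [Complex.ofReal_one] at this
    rw [eng, this, ← eng, hQ1 x hx]
    simp [oR]
  have hQ3r : ∀ x ∈ Icc (0:ℝ) 1, Q a (M 1 : ℝ) (ng (rf (oR mr))) (rf (oR nr)) (rf (oR fun t => (F t).re))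
      (rf (oR fun t => (G t).re)) x = 0 := by
    intro x hx
    have := Q_re (α := a) (m0 := M 1) (m1 := fun x => - mr (1 - x)) (n := fun x => nr (1 - x))
      (by fun_prop) (by fun_prop) (rf_cont hFc) (rf_cont hGc) x
    rw [← eng, ← erf, ← erf, hQ3 x hx, Complex.zero_re, Complex.ofReal_zero] at this
    exact this
  refine ⟨fun t => (F t).re, fun t => (G t).re, ⟨?_, ?_, ?_, ?_⟩, ?_⟩
  · exact Complex.reCLM.contDiff.comp_contDiffOn hFs
  · exact Complex.reCLM.contDiff.comp_contDiffOn hGs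
  · intro x hx
    have := J1Q hMd hNn (fun t => (F t).re) (fun t => (G t).re) (Ico_subset_Icc_self hx)
    rw [hQ1r x (Ico_subset_Icc_self hx), neg_add_cancel] at this
    exact_mod_cast this
  · intro x hx
    have hx' : 2 - x ∈ Icc (0:ℝ) 1 := ⟨by linarith [hx.2], by linarith [hx.1]⟩
    have := J3Q (a := a) hMd hNn (fun t => (F t).re) (fun t => (G t).re) hx'
    rw [hQ3r _ hx', sub_sub_cancel, neg_zero] at this
    exact_mod_cast this
  · rintro f' g' ⟨hf', hg', h1, h3⟩
    obtain ⟨fe, hfe, hfe'⟩ : ∃ fe : ℝ → ℝ, Continuous fe ∧ ∀ x ∈ Icc (0:ℝ) 1, fe x = f' x :=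
      ⟨IccExtend (zero_le_one (α := ℝ)) ((Icc (0:ℝ) 1).restrict f'),
        (continuousOn_iff_continuous_restrict.1 hf'.continuousOn).Icc_extend', fun x hx => IccExtend_of_mem _ _ hx⟩
    obtain ⟨ge, hge, hge'⟩ : ∃ ge : ℝ → ℝ, Continuous ge ∧ ∀ x ∈ Icc (0:ℝ) 1, ge x = g' x :=
      ⟨IccExtend (zero_le_one (α := ℝ)) ((Icc (0:ℝ) 1).restrict g'),
        (continuousOn_iff_continuous_restrict.1 hg'.continuousOn).Icc_extend', fun x hx => IccExtend_of_mem _ _ hx⟩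
    have cf : ∀ x ∈ Icc (0:ℝ) 1, oR fe x = oR f' x := fun x hx => by simp [oR, hfe' x hx]
    have cg : ∀ x ∈ Icc (0:ℝ) 1, oR ge x = oR g' x := fun x hx => by simp [oR, hge' x hx]
    have hcmr := oR_cont hmrc
    have hcnr := oR_cont hnrc
    have q1 : ∀ x ∈ Icc (0:ℝ) 1, Q 1 (M 0 : ℝ) (oR mr) (ng (oR nr)) (oR fe) (oR ge) x = - oR nr x := by
      have hQc : Continuous (Q 1 (M 0 : ℝ) (oR mr) (ng (oR nr)) (oR fe) (oR ge)) := by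
        have a1 := cv_cont (oR_cont hfe) hcmr
        have a2 := cv_cont (oR_cont hge) (ng_cont hcnr)
        have a3 := oR_cont hfe
        have a4 := oR_cont hge
        unfold Q
        fun_prop
      have hcl : IsClosed {x | Q 1 (M 0 : ℝ) (oR mr) (ng (oR nr)) (oR fe) (oR ge) x = - oR nr x} :=
        isClosed_eq hQc hcnr.neg
      have hI : Ico (0:ℝ) 1 ⊆ {x | Q 1 (M 0 : ℝ) (oR mr) (ng (oR nr)) (oR fe) (oR ge) x = - oR nr x} := by
        intro x hx
        have hx' := Ico_subset_Icc_self hx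
        have := J1Q hMd hNn f' g' hx'
        rw [h1 x hx, Complex.ofReal_zero, ← Q_congr cf cg hx'] at this
        simp only [mem_setOf_eq]
        linear_combination -this
      have := closure_minimal hI hcl
      rw [closure_Ico (by norm_num)] at this
      exact this
    have q3 : ∀ x ∈ Icc (0:ℝ) 1, Q a (M 1 : ℝ) (ng (rf (oR mr))) (rf (oR nr)) (rf (oR fe)) (rf (oR ge)) x = 0 := by
      intro x hx
      have := J3Q (a := a) hMd hNn f' g' hx
      rw [h3 (2 - x) ⟨by linarith [hx.2], by linarith [hx.1]⟩, Complex.ofReal_zero] at this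
      rw [Q_congr (f' := rf (oR f')) (g' := rf (oR g')) (f := rf (oR fe)) (g := rf (oR ge))
        (fun y hy => cf _ (one_sub_mem hy)) (fun y hy => cg _ (one_sub_mem hy)) hx]
      exact neg_eq_zero.1 this.symm
    -- difference
    have Qadd : ∀ (α m0 : ℂ) (m1 n f g f2 g2 : ℝ → ℂ), Continuous m1 → Continuous n → Continuous f →
        Continuous g → Continuous f2 → Continuous g2 → ∀ x,
        Q α m0 m1 n (fun t => f t + ng f2 t) (fun t => g t + ng g2 t) x = Q α m0 m1 n f g x - Q α m0 m1 n f2 g2 x := by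
      intro α m0 m1 n f g f2 g2 hm1 hn hf hg hf2 hg2 x
      have := Q_neg (α := α) (m0 := m0) (m1 := m1) (n := n) (f := f2) (g := g2) x
      rw [sub_eq_add_neg, ← this]
      unfold Q
      rw [cv_add_left hf (ng_cont hf2) hm1, cv_add_left hg (ng_cont hg2) hn]
      ring
    have cF : Continuous (oR fun t => (F t).re) := oR_cont (by fun_prop)
    have cG : Continuous (oR fun t => (G t).re) := oR_cont (by fun_prop)
    obtain ⟨u1, u2⟩ := huniq (fun t => oR fe t + ng (oR fun t => (F t).re) t)
      (fun t => oR ge t + ng (oR fun t => (G t).re) t)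
      ((oR_cont hfe).add (ng_cont cF)) ((oR_cont hge).add (ng_cont cG))
      (by
        intro x hx
        rw [Qadd _ _ _ _ _ _ _ _ hcmr (ng_cont hcnr) (oR_cont hfe) (oR_cont hge) cF cG, q1 x hx, hQ1r x hx, sub_self])
      (by
        intro x hx
        have := Qadd a (M 1 : ℝ) _ _ _ _ _ _ (ng_cont (rf_cont hcmr)) (rf_cont hcnr) (rf_cont (oR_cont hfe))
          (rf_cont (oR_cont hge)) (rf_cont cF) (rf_cont cG) x
        rw [q3 x hx, hQ3r x hx, sub_self] at this
        exact this)
    constructor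
    · intro x hx
      have := u1 x hx
      simp only [ng, oR] at this
      rw [← hfe' x hx]
      have h2 : ((fe x : ℝ) : ℂ) = ((F x).re : ℝ) := by linear_combination this
      exact_mod_cast h2
    · intro x hx
      have := u2 x hx
      simp only [ng, oR] at this
      rw [← hge' x hx]
      have h2 : ((ge x : ℝ) : ℂ) = ((G x).re : ℝ) := by linear_combination this
      exact_mod_cast h2
end
end

section
/- Let 0 < τ₀ ≤ τ₁, a, b ∈ ℝ, and let N, f : [0,τ₀] → ℝ and M, g : [0,τ₁] → ℝ be piecewise continuous. Then for every s ∈ ℂ, (1 − a·e^{−τ₀s} − ∫₀^{τ₀} N(ν)e^{−νs}dν)·(1 − ∫₀^{τ₁} g(ν)e^{−νs}dν) − (b·e^{−τ₁s} + ∫₀^{τ₁} M(ν)e^{−νs}dν)·(∫₀^{τ₀} f(ν)e^{−νs}dν) = 1 − a·e^{−τ₀s} − ∫₀^{τ₀} e^{−νs}I₁(ν)dν − ∫_{τ₀}^{τ₁} e^{−νs}I₂(ν)dν − ∫_{τ₁}^{τ₀+τ₁} e^{−νs}I₃(ν)dν. -/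
open MeasureTheory Set

noncomputable section

/-- A piecewise continuous function is integrable. -/
lemma pw_integrable {f : ℝ → ℝ} {p : ℝ} (h : PwContOn f 0 p) :
    IntegrableOn f (Icc 0 p) := by
  obtain ⟨⟨S, hS⟩, C, hC⟩ := h
  have hm : MeasurableSet (Icc 0 p \ (S : Set ℝ)) :=
    measurableSet_Icc.diff S.finite_toSet.measurableSet
  have h1 : IntegrableOn f (Icc 0 p \ (S : Set ℝ)) := by
    refine IntegrableOn.of_bound ?_ (hS.aestronglyMeasurable hm) C ?_
    · exact lt_of_le_of_lt (measure_mono sdiff_subset) (by simp)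
    · exact (ae_restrict_iff' hm).2 (Filter.Eventually.of_forall fun x hx => hC x hx.1)
  refine h1.congr_set_ae ?_
  exact (sdiff_null_ae_eq_self (S.finite_toSet.measure_zero volume)).symm

lemma pw_exp_integrable {f : ℝ → ℝ} {p : ℝ} (s : ℂ) (h : PwContOn f 0 p) :
    IntegrableOn (fun ν => (f ν : ℂ) * Complex.exp (-(ν : ℂ) * s)) (Icc 0 p) := by
  have h1 : IntegrableOn (fun ν => (f ν : ℂ)) (Icc 0 p) := (pw_integrable h).ofReal
  exact h1.mul_continuousOn (by fun_prop) isCompact_Icc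

lemma conv_pieces (p q : ℝ) (F G : ℝ → ℝ) (s : ℂ) (hp : 0 < p) (hpq : p ≤ q)
    (hF : PwContOn F 0 p) (hG : PwContOn G 0 q) :
    IntervalIntegrable (fun ν : ℝ => Complex.exp (-(ν:ℂ) * s) *
      ((∫ η in (0:ℝ)..ν, F η * G (ν - η) : ℝ) : ℂ)) volume 0 p ∧
    IntervalIntegrable (fun ν : ℝ => Complex.exp (-(ν:ℂ) * s) *
      ((∫ η in (0:ℝ)..p, F η * G (ν - η) : ℝ) : ℂ)) volume p q ∧
    IntervalIntegrable (fun ν : ℝ => Complex.exp (-(ν:ℂ) * s) *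
      ((∫ η in (ν-q)..p, F η * G (ν - η) : ℝ) : ℂ)) volume q (p+q) ∧
    (∫ ν in (0:ℝ)..p, (F ν : ℂ) * Complex.exp (-(ν:ℂ) * s)) *
      (∫ ν in (0:ℝ)..q, (G ν : ℂ) * Complex.exp (-(ν:ℂ) * s)) =
    (∫ ν in (0:ℝ)..p, Complex.exp (-(ν:ℂ) * s) *
      ((∫ η in (0:ℝ)..ν, F η * G (ν - η) : ℝ) : ℂ)) +
    (∫ ν in p..q, Complex.exp (-(ν:ℂ) * s) *
      ((∫ η in (0:ℝ)..p, F η * G (ν - η) : ℝ) : ℂ)) +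
    (∫ ν in q..(p+q), Complex.exp (-(ν:ℂ) * s) *
      ((∫ η in (ν-q)..p, F η * G (ν - η) : ℝ) : ℂ)) := by
  set F' : ℝ → ℂ := (Ioc 0 p).indicator
    (fun ν => (F ν : ℂ) * Complex.exp (-(ν : ℂ) * s)) with hF'
  set G' : ℝ → ℂ := (Ico 0 q).indicator
    (fun ν => (G ν : ℂ) * Complex.exp (-(ν : ℂ) * s)) with hG'
  have iF : Integrable F' :=
    ((pw_exp_integrable s hF).mono_set Ioc_subset_Icc_self).integrable_indicator measurableSet_Ioc
  have iG : Integrable G' :=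
    ((pw_exp_integrable s hG).mono_set Ico_subset_Icc_self).integrable_indicator measurableSet_Ico
  set H : ℝ → ℂ := convolution F' G' (ContinuousLinearMap.mul ℝ ℂ) volume with hH
  have iH : Integrable H := iF.integrable_convolution _ iG
  have eH : ∫ x, H x = (∫ x, F' x) * (∫ x, G' x) := by
    rw [hH, integral_convolution _ iF iG]; rfl
  have key : ∀ ν : ℝ, H ν = Complex.exp (-(ν:ℂ) * s) *
      ((∫ η in Ioc (max 0 (ν - q)) (min p ν), F η * G (ν - η) : ℝ) : ℂ) := by
    intro ν
    have : ∀ t, (ContinuousLinearMap.mul ℝ ℂ) (F' t) (G' (ν - t)) =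
        (Ioc (max 0 (ν - q)) (min p ν)).indicator
          (fun t => Complex.exp (-(ν:ℂ) * s) * ((F t * G (ν - t) : ℝ) : ℂ)) t := by
      intro t
      simp only [hF', hG', ContinuousLinearMap.mul_apply', indicator_apply]
      by_cases ht : t ∈ Ioc (max 0 (ν - q)) (min p ν)
      · have h1 : t ∈ Ioc 0 p := by
          simp only [mem_Ioc, max_lt_iff, le_min_iff] at ht ⊢; tauto
        have h2 : ν - t ∈ Ico 0 q := by
          simp only [mem_Ioc, mem_Ico, max_lt_iff, le_min_iff] at ht ⊢
          constructor <;> linarith [ht.1.2, ht.2.2]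
        rw [if_pos h1, if_pos h2, if_pos ht]
        have : Complex.exp (-(ν:ℂ) * s) =
            Complex.exp (-(t:ℂ) * s) * Complex.exp (-((ν - t : ℝ):ℂ) * s) := by
          rw [← Complex.exp_add]; congr 1; push_cast; ring
        rw [this]; push_cast; ring
      · rw [if_neg ht]
        by_cases h1 : t ∈ Ioc 0 p
        · have h2 : ν - t ∉ Ico 0 q := by
            intro h2
            apply ht
            simp only [mem_Ioc, mem_Ico, max_lt_iff, le_min_iff] at h1 h2 ⊢
            refine ⟨⟨h1.1, by linarith⟩, h1.2, by linarith⟩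
          rw [if_neg h2, mul_zero]
        · rw [if_neg h1, zero_mul]
    rw [hH, convolution_def]
    simp_rw [this]
    rw [integral_indicator measurableSet_Ioc, integral_const_mul]
    congr 1
    exact integral_ofReal
  have k1 : ∀ ν ∈ uIoc 0 p, H ν = Complex.exp (-(ν:ℂ) * s) *
      ((∫ η in (0:ℝ)..ν, F η * G (ν - η) : ℝ) : ℂ) := by
    intro ν hν
    rw [uIoc_of_le hp.le] at hν
    rw [key, max_eq_left (by linarith [hν.2]), min_eq_right hν.2,
      intervalIntegral.integral_of_le hν.1.le]
  have k2 : ∀ ν ∈ uIoc p q, H ν = Complex.exp (-(ν:ℂ) * s) *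
      ((∫ η in (0:ℝ)..p, F η * G (ν - η) : ℝ) : ℂ) := by
    intro ν hν
    rw [uIoc_of_le hpq] at hν
    rw [key, max_eq_left (by linarith [hν.2]), min_eq_left hν.1.le,
      intervalIntegral.integral_of_le hp.le]
  have k3 : ∀ ν ∈ uIoc q (p+q), H ν = Complex.exp (-(ν:ℂ) * s) *
      ((∫ η in (ν-q)..p, F η * G (ν - η) : ℝ) : ℂ) := by
    intro ν hν
    rw [uIoc_of_le (by linarith)] at hν
    rw [key, max_eq_right (by linarith [hν.1]), min_eq_left (by linarith [hν.1]),
      intervalIntegral.integral_of_le (by linarith [hν.2])]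
  have ii : ∀ u v : ℝ, IntervalIntegrable H volume u v := fun u v => iH.intervalIntegrable
  refine ⟨(ii 0 p).congr k1, (ii p q).congr k2, (ii q (p+q)).congr k3, ?_⟩
  have c : ∀ {u v : ℝ} {K : ℝ → ℂ}, (∀ ν ∈ uIoc u v, H ν = K ν) →
      ∫ ν in u..v, K ν = ∫ ν in u..v, H ν := fun h =>
    intervalIntegral.integral_congr_ae (Filter.Eventually.of_forall fun x hx => (h x hx).symm)
  rw [c k1, c k2, c k3, intervalIntegral.integral_add_adjacent_intervals (ii _ _) (ii _ _),
    intervalIntegral.integral_add_adjacent_intervals (ii _ _) (ii _ _),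
    intervalIntegral.integral_of_le hp.le, intervalIntegral.integral_of_le (hp.le.trans hpq),
    intervalIntegral.integral_of_le (by linarith), integral_Ioc_eq_integral_Ioo (y := q),
    ← integral_Ico_eq_integral_Ioo,
    ← integral_indicator measurableSet_Ioc, ← integral_indicator measurableSet_Ico, ← hF', ← hG',
    ← eH, setIntegral_eq_integral_of_ae_compl_eq_zero]
  have h0 : ∀ᵐ x : ℝ, x ≠ 0 := by simp [ae_iff]
  filter_upwards [h0] with x hx0 hx
  rw [key, Ioc_eq_empty, setIntegral_empty]
  · simp
  · rw [lt_min_iff, max_lt_iff, max_lt_iff]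
    intro h
    exact hx ⟨h.2.1, by linarith [h.1.2]⟩

/-- **Characteristic-equation identity (b ≠ 0 case).** For all `s ∈ ℂ`,
`F₀(s)(1 - ∫₀^{τ₁} g e^{-νs}) - F₁(s)(∫₀^{τ₀} f e^{-νs})
  = 1 - a e^{-τ₀ s} - ∫₀^{τ₀} e^{-νs} I₁ - ∫_{τ₀}^{τ₁} e^{-νs} I₂ - ∫_{τ₁}^{τ₀+τ₁} e^{-νs} I₃`. -/
theorem stmt7
    (τ₀ τ₁ a b : ℝ) (N M f g : ℝ → ℝ)
    (hτ₀ : 0 < τ₀) (hττ : τ₀ ≤ τ₁)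
    (hN : PwContOn N 0 τ₀) (hf : PwContOn f 0 τ₀)
    (hM : PwContOn M 0 τ₁) (hg : PwContOn g 0 τ₁)
    (s : ℂ) :
    (1 - (a : ℂ) * Complex.exp (-(τ₀:ℂ) * s)
        - ∫ ν in (0:ℝ)..τ₀, (N ν : ℂ) * Complex.exp (-(ν:ℂ) * s))
      * (1 - ∫ ν in (0:ℝ)..τ₁, (g ν : ℂ) * Complex.exp (-(ν:ℂ) * s))
    - ((b : ℂ) * Complex.exp (-(τ₁:ℂ) * s)
        + ∫ ν in (0:ℝ)..τ₁, (M ν : ℂ) * Complex.exp (-(ν:ℂ) * s))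
      * (∫ ν in (0:ℝ)..τ₀, (f ν : ℂ) * Complex.exp (-(ν:ℂ) * s))
    = 1 - (a : ℂ) * Complex.exp (-(τ₀:ℂ) * s)
      - (∫ ν in (0:ℝ)..τ₀, Complex.exp (-(ν:ℂ) * s) * (I1 N M f g ν : ℂ))
      - (∫ ν in τ₀..τ₁, Complex.exp (-(ν:ℂ) * s) * (I2 a τ₀ N M f g ν : ℂ))
      - ∫ ν in τ₁..(τ₀ + τ₁), Complex.exp (-(ν:ℂ) * s) * (I3 a b τ₀ τ₁ N M f g ν : ℂ) := by
  obtain ⟨A1, A2, A3, A⟩ := conv_pieces τ₀ τ₁ f M s hτ₀ hττ hf hM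
  obtain ⟨B1, B2, B3, B⟩ := conv_pieces τ₀ τ₁ N g s hτ₀ hττ hN hg
  have jN : IntervalIntegrable (fun ν : ℝ => (N ν : ℂ) * Complex.exp (-(ν:ℂ) * s)) volume 0 τ₀ :=
    (intervalIntegrable_iff_integrableOn_Icc_of_le hτ₀.le).2 (pw_exp_integrable s hN)
  have jf : IntervalIntegrable (fun ν : ℝ => (f ν : ℂ) * Complex.exp (-(ν:ℂ) * s)) volume 0 τ₀ :=
    (intervalIntegrable_iff_integrableOn_Icc_of_le hτ₀.le).2 (pw_exp_integrable s hf)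
  have jg : IntervalIntegrable (fun ν : ℝ => (g ν : ℂ) * Complex.exp (-(ν:ℂ) * s)) volume 0 τ₁ :=
    (intervalIntegrable_iff_integrableOn_Icc_of_le (hτ₀.le.trans hττ)).2 (pw_exp_integrable s hg)
  have jg1 : IntervalIntegrable (fun ν : ℝ => (g ν : ℂ) * Complex.exp (-(ν:ℂ) * s)) volume 0 τ₀ :=
    jg.mono_set (by rw [uIcc_of_le hτ₀.le, uIcc_of_le (hτ₀.le.trans hττ)]
                    exact Icc_subset_Icc_right hττ)
  have jg2 : IntervalIntegrable (fun ν : ℝ => (g ν : ℂ) * Complex.exp (-(ν:ℂ) * s)) volume τ₀ τ₁ :=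
    jg.mono_set (by rw [uIcc_of_le hττ, uIcc_of_le (hτ₀.le.trans hττ)]
                    exact Icc_subset_Icc_left hτ₀.le)
  have sh : ∀ (c : ℝ) (h : ℝ → ℝ) (d u v : ℝ),
      IntervalIntegrable (fun ν : ℝ => (h ν : ℂ) * Complex.exp (-(ν:ℂ) * s)) volume u v →
      IntervalIntegrable (fun ν : ℝ => Complex.exp (-(ν:ℂ) * s) * ((c * h (ν - d) : ℝ) : ℂ))
        volume (u + d) (v + d) ∧
      ∫ ν in (u + d)..(v + d), Complex.exp (-(ν:ℂ) * s) * ((c * h (ν - d) : ℝ) : ℂ) =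
        (c : ℂ) * Complex.exp (-(d:ℂ) * s) *
          ∫ ν in u..v, (h ν : ℂ) * Complex.exp (-(ν:ℂ) * s) := by
    intro c h d u v hh
    have e : (fun ν : ℝ => Complex.exp (-(ν:ℂ) * s) * ((c * h (ν - d) : ℝ) : ℂ)) =
        fun ν : ℝ => (fun x : ℝ => (c : ℂ) * Complex.exp (-(d:ℂ) * s) *
          ((h x : ℂ) * Complex.exp (-(x:ℂ) * s))) (ν - d) := by
      funext ν
      have : Complex.exp (-(ν:ℂ) * s) =
          Complex.exp (-(d:ℂ) * s) * Complex.exp (-((ν - d : ℝ):ℂ) * s) := by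
        rw [← Complex.exp_add]; congr 1; push_cast; ring
      rw [this]; push_cast; ring
    rw [e]
    constructor
    · exact (hh.const_mul _).comp_sub_right d
    · rw [intervalIntegral.integral_comp_sub_right (fun x : ℝ => (c : ℂ) *
        Complex.exp (-(d:ℂ) * s) * ((h x : ℂ) * Complex.exp (-(x:ℂ) * s))) d, add_sub_cancel_right, add_sub_cancel_right,
        intervalIntegral.integral_const_mul]
  obtain ⟨P, P'⟩ := sh b f τ₁ 0 τ₀ jf
  rw [zero_add] at P P'
  obtain ⟨Q, Q'⟩ := sh a g τ₀ 0 τ₁ jg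
  rw [zero_add, add_comm τ₁ τ₀] at Q Q'
  have Q2 := Q.mono_set (c := τ₀) (d := τ₁) (by
    rw [uIcc_of_le hττ, uIcc_of_le (by linarith)]; exact Icc_subset_Icc_right (by linarith))
  have Q3 := Q.mono_set (c := τ₁) (d := τ₀ + τ₁) (by
    rw [uIcc_of_le (by linarith), uIcc_of_le (by linarith)]; exact Icc_subset_Icc_left hττ)
  rw [← intervalIntegral.integral_add_adjacent_intervals Q2 Q3] at Q'
  have swap : ∀ u v ν : ℝ, ∫ η in u..v, g η * N (ν - η) =
      ∫ η in (ν - v)..(ν - u), N η * g (ν - η) := by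
    intro u v ν
    rw [← intervalIntegral.integral_comp_sub_left (fun x => N x * g (ν - x)) ν]
    refine intervalIntegral.integral_congr fun x _ => ?_
    simp [mul_comm]
  have comb : ∀ (σ : ℂ) (u v : ℝ) (K w x y z : ℝ → ℂ), IntervalIntegrable w volume u v →
      IntervalIntegrable x volume u v → IntervalIntegrable y volume u v →
      IntervalIntegrable z volume u v → (∀ ν, K ν = w ν + σ * x ν + y ν - z ν) →
      ∫ ν in u..v, K ν = (∫ ν in u..v, w ν) + σ * (∫ ν in u..v, x ν) + (∫ ν in u..v, y ν)
        - ∫ ν in u..v, z ν := by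
    intro σ u v K w x y z hw hx hy hz hK
    simp_rw [hK]
    rw [intervalIntegral.integral_sub ((hw.add (hx.const_mul σ)).add hy) hz,
      intervalIntegral.integral_add (hw.add (hx.const_mul σ)) hy,
      intervalIntegral.integral_add hw (hx.const_mul σ), intervalIntegral.integral_const_mul]
  have E1 := comb 1 0 τ₀ (fun ν => Complex.exp (-(ν:ℂ) * s) * (I1 N M f g ν : ℂ))
    _ _ _ _ jg1 jN A1 B1 (by
      intro ν
      simp only [I1, swap, sub_zero, sub_self]
      push_cast; ring)
  have E2 := comb (-1) τ₀ τ₁ (fun ν => Complex.exp (-(ν:ℂ) * s) * (I2 a τ₀ N M f g ν : ℂ))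
    _ _ _ _ jg2 Q2 A2 B2 (by
      intro ν
      simp only [I2, swap, sub_sub_cancel, sub_self]
      push_cast; ring)
  have E3 := comb (-1) τ₁ (τ₀ + τ₁)
    (fun ν => Complex.exp (-(ν:ℂ) * s) * (I3 a b τ₀ τ₁ N M f g ν : ℂ))
    _ _ _ _ P Q3 A3 B3 (by
      intro ν
      simp only [I3, swap, sub_sub_cancel]
      push_cast; ring)
  have Gs := intervalIntegral.integral_add_adjacent_intervals jg1 jg2
  rw [E1, E2, E3]
  linear_combination B - A + P' - Q' + Gs
end
end
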